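/- arXiv:2007.06652 — 3 statements merged into one kernel-verified Lean document; each statement's English description precedes it below -/
import Mathlib

section
/- For any positive integers n and t, the number of t-core partitions of n is at least p(n) − (t+1)·p(n−t), where p(·) is the partition function (with p(m)=0 for m<0). -/
open scoped BigOperators

def rowLen {n : ℕ} (μ : Nat.Partition n) (i : ℕ) : ℕ :=
  ((μ.parts.sort (· ≤ ·)).reverse).getD i 0

def colLen {n : ℕ} (μ : Nat.Partition n) (j : ℕ) : ℕ :=
  (μ.parts.filter (fun a => j < a)).card

def hookLen {n : ℕ} (μ : Nat.Partition n) (i j : ℕ) : ℕ :=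
  (rowLen μ i - j) + (colLen μ j - i) - 1

/-- `μ` is a `t`-core: no box of its Young diagram has hook length divisible by `t`. -/
def IsTCore {n : ℕ} (t : ℕ) (μ : Nat.Partition n) : Prop :=
  ∀ i j, j < rowLen μ i → ¬ t ∣ hookLen μ i j


/-- A bead with a gap below it on its runner. -/
def Bad (t : ℕ) (B : Finset ℕ) (b : ℕ) : Prop :=
  b ∈ B ∧ ∃ g, g ∉ B ∧ g < b ∧ t ∣ b - g

/-- A bead immediately above the first gap of its runner. -/
def FirstGap (t : ℕ) (B : Finset ℕ) (b : ℕ) : Prop :=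
  b ∈ B ∧ t ≤ b ∧ b - t ∉ B ∧ ∀ g, g < b - t → t ∣ (b - t) - g → g ∈ B

/-- Move the bead `b` down by `t`. -/
def mv (t : ℕ) (B : Finset ℕ) (b : ℕ) : Finset ℕ := insert (b - t) (B.erase b)

lemma mv_inj {t : ℕ} {B C : Finset ℕ} {b : ℕ} (hB : b ∈ B) (hC : b ∈ C) (hB' : b - t ∉ B)
    (hC' : b - t ∉ C) (h : mv t B b = mv t C b) : B = C := by
  unfold mv at h
  ext x
  have := Finset.ext_iff.mp h x
  simp only [Finset.mem_insert, Finset.mem_erase] at this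
  by_cases h1 : x = b
  · subst h1; simp [hB, hC]
  · by_cases h2 : x = b - t
    · subst h2; simp [hB', hC']
    · simpa [h1, h2] using this

lemma mv_card {t : ℕ} {B : Finset ℕ} {b : ℕ} (hB : b ∈ B) (hB' : b - t ∉ B) :
    (mv t B b).card = B.card := by
  unfold mv
  rw [Finset.card_insert_of_notMem (by simp [hB']), Finset.card_erase_add_one hB]

lemma mv_sum {t : ℕ} {B : Finset ℕ} {b : ℕ} (hB : b ∈ B) (hB' : b - t ∉ B) (ht : t ≤ b) :
    (∑ x ∈ mv t B b, x) + t = ∑ x ∈ B, x := by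
  unfold mv
  rw [Finset.sum_insert (by simp [hB'])]
  have := Finset.add_sum_erase B (fun x => x) hB
  omega

lemma one_inj {t : ℕ} (ht : 0 < t) {B C : Finset ℕ} {b c : ℕ} (hB : FirstGap t B b) (hC : FirstGap t C c)
    (hr : b % t = c % t) (h : mv t B b = mv t C c) : b = c := by
  wlog hlt : b < c generalizing b c B C
  · by_contra hne
    exact hne (this hC hB hr.symm h.symm (by omega)).symm
  exfalso
  have hd : t ∣ c - b := (Nat.modEq_iff_dvd' hlt.le).mp hr
  have hle : t ≤ c - b := Nat.le_of_dvd (by omega) hd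
  have h1 : b ∈ mv t C c := by
    unfold mv
    simp only [Finset.mem_insert, Finset.mem_erase]
    by_cases hb : b = c - t
    · exact Or.inl hb
    · right
      refine ⟨by omega, hC.2.2.2 b (by omega) ?_⟩
      have : c - t - b = c - b - t := by omega
      rw [this]
      exact Nat.dvd_sub hd dvd_rfl
  rw [← h] at h1
  unfold mv at h1
  simp only [Finset.mem_insert, Finset.mem_erase] at h1
  have := hB.2.1
  rcases h1 with h1 | h1
  · omega
  · exact h1.1 rfl

/-- `b` is the least bad bead. -/
def LeastBad (t : ℕ) (B : Finset ℕ) (b : ℕ) : Prop :=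
  Bad t B b ∧ ∀ c, Bad t B c → b ≤ c

lemma leastBad_step {t : ℕ} (ht : 0 < t) {B : Finset ℕ} {b : ℕ} (h : LeastBad t B b)
    (hno : ¬ FirstGap t B b) : t ≤ b ∧ b - t ∉ B ∧ LeastBad t (mv t B b) (b - t) := by
  obtain ⟨⟨hb, g, hg, hgb, hd⟩, hmin⟩ := h
  have hle : t ≤ b - g := Nat.le_of_dvd (by omega) hd
  have htb : t ≤ b := by omega
  have hnb : b - t ∉ B := by
    intro hmem
    have hne : g ≠ b - t := by rintro rfl; exact hg hmem
    have := hmin (b - t) ⟨hmem, g, hg, by omega, by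
      have : b - t - g = b - g - t := by omega
      rw [this]; exact Nat.dvd_sub hd dvd_rfl⟩
    omega
  refine ⟨htb, hnb, ?_, ?_⟩
  · have : ∃ g, g < b - t ∧ t ∣ (b - t) - g ∧ g ∉ B := by
      by_contra hcon
      push Not at hcon
      exact hno ⟨hb, htb, hnb, hcon⟩
    obtain ⟨g', h1, h2, h3⟩ := this
    refine ⟨by simp [mv], g', ?_, h1, h2⟩
    simp only [mv, Finset.mem_insert, Finset.mem_erase]
    rintro (h | h)
    · omega
    · exact h3 h.2
  · rintro c ⟨hc, g', hg', hgc, hdc⟩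
    simp only [mv, Finset.mem_insert, Finset.mem_erase] at hc hg'
    push Not at hg'
    rcases hc with hc | ⟨hc1, hc2⟩
    · omega
    · by_cases hgb' : g' = b
      · omega
      · have := hmin c ⟨hc2, g', hg'.2 hgb', hgc, hdc⟩
        omega

/-- Beta-sets of size `N`. -/
def BSet (N n : ℕ) : Set (Finset ℕ) :=
  {B | B.card = N ∧ ∑ x ∈ B, x = n + ∑ i : Fin N, (i : ℕ)}

lemma exists_code {t N n m : ℕ} (ht : 0 < t) (hm : m + t = n) :
    ∃ F : {B : Finset ℕ // B ∈ BSet N n ∧ ∃ b, Bad t B b} → BSet N m × Option (Fin t),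
      Function.Injective F := by
  classical
  have key : ∀ B : {B : Finset ℕ // B ∈ BSet N n ∧ ∃ b, Bad t B b},
      ∃ b, b ∈ B.1 ∧ t ≤ b ∧ b - t ∉ B.1 ∧
        (FirstGap t B.1 b ∨ ((¬ ∃ c, FirstGap t B.1 c) ∧ LeastBad t B.1 b)) := by
    rintro ⟨B, hB, hbad⟩
    by_cases h : ∃ c, FirstGap t B c
    · obtain ⟨c, hc⟩ := h
      exact ⟨c, hc.1, hc.2.1, hc.2.2.1, Or.inl hc⟩
    · have hl : LeastBad t B (Nat.find hbad) :=
        ⟨Nat.find_spec hbad, fun c hc => Nat.find_min' hbad hc⟩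
      have := leastBad_step ht hl (fun h' => h ⟨_, h'⟩)
      exact ⟨_, hl.1.1, this.1, this.2.1, Or.inr ⟨h, hl⟩⟩
  choose f hf1 hf2 hf3 hf4 using key
  have hmem : ∀ B, mv t B.1 (f B) ∈ BSet N m := by
    intro B
    refine ⟨(mv_card (hf1 B) (hf3 B)).trans B.2.1.1, ?_⟩
    have h1 := mv_sum (hf1 B) (hf3 B) (hf2 B)
    have h2 := B.2.1.2
    omega
  refine ⟨fun B => (⟨mv t B.1 (f B), hmem B⟩,
    if FirstGap t B.1 (f B) then some ⟨f B % t, Nat.mod_lt _ ht⟩ else none), ?_⟩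
  intro B C h
  simp only [Prod.mk.injEq, Subtype.mk.injEq] at h
  obtain ⟨h1, h2⟩ := h
  have hbc : f B = f C := by
    by_cases hB : FirstGap t B.1 (f B) <;> by_cases hC : FirstGap t C.1 (f C)
    · simp only [hB, hC, if_true, Option.some.injEq, Fin.mk.injEq] at h2
      exact one_inj ht hB hC h2 h1
    · simp [hB, hC] at h2
    · simp [hB, hC] at h2
    · have lB := (leastBad_step ht ((hf4 B).resolve_left hB).2 hB).2.2
      have lC := (leastBad_step ht ((hf4 C).resolve_left hC).2 hC).2.2
      rw [h1] at lB
      have e1 := lB.2 _ lC.1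
      have e2 := lC.2 _ lB.1
      have := hf2 B
      have := hf2 C
      omega
  apply Subtype.ext
  have k1 := hf1 C
  have k3 := hf3 C
  rw [← hbc] at k1 k3 h1
  exact mv_inj (hf1 B) k1 (hf3 B) k3 h1

lemma le_orderEmb {N : ℕ} (f : Fin N ↪o ℕ) (i : Fin N) : (i : ℕ) ≤ f i := by
  obtain ⟨i, hi⟩ := i
  induction i with
  | zero => simp
  | succ k ih =>
    have h1 := ih (by omega)
    have h2 : f ⟨k, by omega⟩ < f ⟨k + 1, hi⟩ := f.strictMono (by simp)
    simp only at h1 ⊢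
    omega

lemma sum_orderEmb {N : ℕ} (B : Finset ℕ) (h : B.card = N) :
    ∑ i, B.orderEmbOfFin h i = ∑ x ∈ B, x := by
  conv_rhs => rw [← Finset.image_orderEmbOfFin_univ B h]
  rw [Finset.sum_image (fun a _ b _ hab => (B.orderEmbOfFin h).injective hab)]

lemma sum_ge {N : ℕ} (B : Finset ℕ) (h : B.card = N) :
    ∑ i : Fin N, (i : ℕ) ≤ ∑ x ∈ B, x := by
  rw [← sum_orderEmb B h]
  exact Finset.sum_le_sum (fun i _ => le_orderEmb _ i)

lemma bad_le {t N n : ℕ} (ht : 0 < t) {B : Finset ℕ} (hB : B ∈ BSet N n)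
    (h : ∃ b, Bad t B b) : t ≤ n := by
  classical
  have hl : LeastBad t B (Nat.find h) :=
    ⟨Nat.find_spec h, fun c hc => Nat.find_min' h hc⟩
  have : Nat.find h ∈ B ∧ t ≤ Nat.find h ∧ Nat.find h - t ∉ B := by
    by_cases h1 : FirstGap t B (Nat.find h)
    · exact ⟨h1.1, h1.2.1, h1.2.2.1⟩
    · have := leastBad_step ht hl h1
      exact ⟨hl.1.1, this.1, this.2.1⟩
  obtain ⟨a, b, c⟩ := this
  have h1 := mv_sum a c b
  have h2 := sum_ge _ ((mv_card a c).trans hB.1)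
  have h3 := hB.2
  omega

/-- From beta-sets to partitions. -/
lemma exists_toPart (N n : ℕ) :
    ∃ F : BSet N n → Nat.Partition n, Function.Injective F := by
  classical
  let a : BSet N n → Fin N → ℕ := fun B i => B.1.orderEmbOfFin B.2.1 i - i
  have ha : ∀ B i, a B i + i = B.1.orderEmbOfFin B.2.1 i := fun B i => by
    have := le_orderEmb (B.1.orderEmbOfFin B.2.1) i
    simp only [a]; omega
  have hmono : ∀ B, Monotone (a B) := by
    intro B
    rcases N with _ | N
    · intro i; exact i.elim0
    · rw [Fin.monotone_iff_le_succ]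
      intro i
      have h1 := ha B i.castSucc
      have h2 := ha B i.succ
      have h3 : B.1.orderEmbOfFin B.2.1 i.castSucc < B.1.orderEmbOfFin B.2.1 i.succ :=
        (B.1.orderEmbOfFin B.2.1).strictMono (Fin.castSucc_lt_succ)
      simp only [Fin.val_castSucc, Fin.val_succ] at h1 h2
      omega
  have hsum : ∀ B, ((List.ofFn (a B) : List ℕ) : Multiset ℕ).sum = n := by
    intro B
    rw [Multiset.sum_coe, List.sum_ofFn]
    have h1 : ∑ i, (a B i + i) = ∑ i, B.1.orderEmbOfFin B.2.1 i :=
      Finset.sum_congr rfl (fun i _ => ha B i)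
    rw [Finset.sum_add_distrib, sum_orderEmb, B.2.2] at h1
    omega
  refine ⟨fun B => Nat.Partition.ofSums n _ (hsum B), ?_⟩
  intro B C h
  have h := congrArg Nat.Partition.parts h
  simp only [Nat.Partition.ofSums_parts] at h
  have hc : ((List.ofFn (a B) : List ℕ) : Multiset ℕ) = (List.ofFn (a C) : List ℕ) := by
    have hfil : ∀ M : Multiset ℕ, M = M.filter (· ≠ 0)
        + Multiset.replicate (M.card - (M.filter (· ≠ 0)).card) 0 := by
      intro M
      have h1 := Multiset.filter_add_not (· ≠ 0) M
      have h2 : M.filter (fun x => ¬ (x ≠ 0)) =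
          Multiset.replicate (M.filter (fun x => ¬ (x ≠ 0))).card 0 := by
        apply Multiset.eq_replicate_card.mpr
        intro b hb
        simpa using (Multiset.mem_filter.mp hb).2
      have h3 := congrArg Multiset.card h1
      rw [Multiset.card_add] at h3
      have h4 : (M.filter (fun x => ¬ (x ≠ 0))).card = M.card - (M.filter (· ≠ 0)).card := by
        omega
      rw [h4] at h2
      rw [← h2, h1]
    rw [hfil (List.ofFn (a B) : List ℕ), hfil (List.ofFn (a C) : List ℕ), h]
    simp
  have hl : List.ofFn (a B) = List.ofFn (a C) :=
    (Multiset.coe_eq_coe.mp hc).eq_of_sortedLE (hmono B).sortedLE_ofFn (hmono C).sortedLE_ofFn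
  have hab : a B = a C := List.ofFn_injective hl
  apply Subtype.ext
  rw [← Finset.image_orderEmbOfFin_univ B.1 B.2.1, ← Finset.image_orderEmbOfFin_univ C.1 C.2.1]
  congr 1
  funext i
  rw [← ha, ← ha, hab]

lemma filter_length_iff (l : List ℕ) (hl : l.Pairwise (· ≥ ·)) (j k : ℕ) :
    k < (l.filter (fun a => j < a)).length ↔ j < l.getD k 0 := by
  induction l generalizing k with
  | nil => simp
  | cons x l ih =>
    rw [List.pairwise_cons] at hl
    by_cases hx : j < x
    · rw [List.filter_cons_of_pos (by simpa using hx)]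
      cases k with
      | zero => simp [hx]
      | succ k => simp only [List.length_cons, add_lt_add_iff_right, List.getD_cons_succ, ih hl.2]
    · have hnil : ((x :: l).filter (fun a => j < a)) = [] := by
        rw [List.filter_eq_nil_iff]
        intro a ha
        rcases List.mem_cons.mp ha with rfl | ha
        · simpa using hx
        · have := hl.1 a ha
          simp; omega
      rw [hnil]
      have : (x :: l).getD k 0 ≤ x := by
        rw [List.getD_eq_getElem?_getD]
        cases h : (x :: l)[k]? with
        | none => simp
        | some y =>
          have := List.mem_of_getElem? h
          rcases List.mem_cons.mp this with rfl | ha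
          · simp
          · simpa using hl.1 y ha
      simp only [List.length_nil, not_lt_zero, false_iff]; omega

lemma lt_colLen_iff {n : ℕ} (μ : Nat.Partition n) (j k : ℕ) :
    k < colLen μ j ↔ j < rowLen μ k := by
  unfold colLen rowLen
  rw [← filter_length_iff]
  · have : (μ.parts.filter (fun a => j < a)) =
        (((μ.parts.sort (· ≤ ·)).reverse.filter (fun a => j < a) : List ℕ) : Multiset ℕ) := by
      rw [← Multiset.filter_coe, Multiset.coe_reverse, Multiset.sort_eq]
    rw [this, Multiset.coe_card]
  · rw [List.pairwise_reverse]
    exact Multiset.pairwise_sort μ.parts (· ≤ ·)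

lemma rowLen_anti {n : ℕ} (μ : Nat.Partition n) : Antitone (rowLen μ) := by
  intro i k hik
  by_contra h
  push Not at h
  have h1 := (lt_colLen_iff μ (rowLen μ i) k).mpr h
  have h2 := (lt_colLen_iff μ (rowLen μ i) i).mp (by omega)
  omega

lemma length_le {n : ℕ} (μ : Nat.Partition n) : μ.parts.card ≤ n := by
  have := Multiset.card_nsmul_le_sum (s := μ.parts) (a := 1) (fun x hx => μ.parts_pos hx)
  rw [μ.parts_sum] at this
  simpa using this

lemma sum_getD (l : List ℕ) (N : ℕ) (h : l.length ≤ N) :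
    ∑ i ∈ Finset.range N, l.getD i 0 = l.sum := by
  induction l generalizing N with
  | nil => simp
  | cons x l ih =>
    cases N with
    | zero => simp at h
    | succ N =>
      rw [Finset.sum_range_succ']
      simp only [List.getD_cons_succ, List.getD_cons_zero, List.sum_cons]
      rw [ih N (by simpa using h), add_comm]

lemma sum_rowLen {n : ℕ} (μ : Nat.Partition n) : ∑ i ∈ Finset.range n, rowLen μ i = n := by
  unfold rowLen
  rw [sum_getD _ _ (by simpa using length_le μ), List.sum_reverse, ← Multiset.sum_coe,
    Multiset.sort_eq, μ.parts_sum]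

lemma rowLen_zero {n : ℕ} (μ : Nat.Partition n) {i : ℕ} (h : n ≤ i) : rowLen μ i = 0 := by
  unfold rowLen
  apply List.getD_eq_default
  simpa using (length_le μ).trans h

lemma rowLen_inj {n : ℕ} {μ ν : Nat.Partition n} (h : rowLen μ = rowLen ν) : μ = ν := by
  apply Nat.Partition.ext
  have hcol : ∀ j, colLen μ j = colLen ν j := by
    intro j
    have h1 := lt_colLen_iff μ j
    have h2 := lt_colLen_iff ν j
    rw [h] at h1
    have h3 := (h1 (colLen ν j)).trans (h2 (colLen ν j)).symm
    have h4 := (h1 (colLen μ j)).trans (h2 (colLen μ j)).symm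
    omega
  have hcard : μ.parts.card = ν.parts.card := by
    have := hcol 0
    unfold colLen at this
    rwa [Multiset.filter_eq_self.mpr (fun a ha => μ.parts_pos ha),
      Multiset.filter_eq_self.mpr (fun a ha => ν.parts_pos ha)] at this
  have hl : (μ.parts.sort (· ≤ ·)).reverse = (ν.parts.sort (· ≤ ·)).reverse := by
    apply List.ext_getElem
    · simpa using hcard
    · intro i h1 h2
      have := congrFun h i
      unfold rowLen at this
      rwa [List.getD_eq_getElem _ _ h1, List.getD_eq_getElem _ _ h2] at this
  have := List.reverse_injective hl
  rw [← Multiset.sort_eq μ.parts (· ≤ ·), this, Multiset.sort_eq]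

/-- Bead positions. -/
def bead {n : ℕ} (μ : Nat.Partition n) (i : Fin n) : ℕ := rowLen μ (n - 1 - i) + i

lemma bead_strictMono {n : ℕ} (μ : Nat.Partition n) : StrictMono (bead μ) := by
  intro i j hij
  have h1 : (i : ℕ) < j := hij
  have := rowLen_anti μ (show n - 1 - (j : ℕ) ≤ n - 1 - i by omega)
  unfold bead
  omega

/-- The beta-set of a partition. -/
def beta {n : ℕ} (μ : Nat.Partition n) : Finset ℕ := Finset.univ.image (bead μ)

lemma beta_mem {n : ℕ} (μ : Nat.Partition n) : beta μ ∈ BSet n n := by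
  constructor
  · unfold beta
    rw [Finset.card_image_of_injective _ (bead_strictMono μ).injective]
    simp
  · unfold beta
    rw [Finset.sum_image (fun a _ b _ h => (bead_strictMono μ).injective h)]
    unfold bead
    rw [Finset.sum_add_distrib]
    congr 1
    rw [Fin.sum_univ_eq_sum_range (fun i => rowLen μ (n - 1 - i)) n,
      Finset.sum_range_reflect (rowLen μ) n, sum_rowLen]

lemma beta_inj {n : ℕ} {μ ν : Nat.Partition n} (h : beta μ = beta ν) : μ = ν := by
  have hr : Set.range (bead μ) = Set.range (bead ν) := by
    have := congrArg (fun s : Finset ℕ => (s : Set ℕ)) h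
    simpa [beta] using this
  have hb := ((bead_strictMono μ).range_inj (bead_strictMono ν)).mp hr
  apply rowLen_inj
  funext i
  by_cases hi : i < n
  · have := congrFun hb ⟨n - 1 - i, by omega⟩
    unfold bead at this
    have e : n - 1 - (n - 1 - i) = i := by omega
    simp only [e] at this
    omega
  · rw [rowLen_zero μ (by omega), rowLen_zero ν (by omega)]

lemma beta_bad {n t : ℕ} {μ : Nat.Partition n} (h : ¬ IsTCore t μ) : ∃ b, Bad t (beta μ) b := by
  unfold IsTCore at h
  push Not at h
  obtain ⟨i, j, hj, hd⟩ := h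
  have hin : i < n := by
    by_contra hi
    rw [rowLen_zero μ (by omega)] at hj
    omega
  have hic := (lt_colLen_iff μ j i).mpr hj
  have hcn : colLen μ j ≤ n := (Multiset.card_le_card (Multiset.filter_le _ _)).trans (length_le μ)
  refine ⟨rowLen μ i + (n - 1 - i), ?_, j + n - colLen μ j, ?_, ?_, ?_⟩
  · unfold beta
    refine Finset.mem_image.mpr ⟨⟨n - 1 - i, by omega⟩, Finset.mem_univ _, ?_⟩
    unfold bead
    have e : n - 1 - (n - 1 - i) = i := by omega
    simp only [e]
  · unfold beta
    intro hm
    obtain ⟨⟨k, hk⟩, -, hk'⟩ := Finset.mem_image.mp hm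
    unfold bead at hk'
    simp only at hk'
    have := lt_colLen_iff μ j (n - 1 - k)
    omega
  · omega
  · unfold hookLen at hd
    have e : rowLen μ i + (n - 1 - i) - (j + n - colLen μ j) =
        rowLen μ i - j + (colLen μ j - i) - 1 := by omega
    rwa [e]

lemma card_noncore_le (n t : ℕ) (ht : 0 < t) :
    Nat.card {μ : Nat.Partition n // ¬ IsTCore t μ} ≤
      (if t ≤ n then Nat.card (Nat.Partition (n - t)) else 0) * (t + 1) := by
  split_ifs with h
  · obtain ⟨F, hF⟩ := exists_code (t := t) (N := n) (n := n) (m := n - t) ht (by omega)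
    obtain ⟨G, hG⟩ := exists_toPart n (n - t)
    let H : {μ : Nat.Partition n // ¬ IsTCore t μ} → Nat.Partition (n - t) × Option (Fin t) :=
      fun μ => Prod.map G id (F ⟨beta μ.1, beta_mem μ.1, beta_bad μ.2⟩)
    have hH : Function.Injective H := by
      intro μ ν hμν
      have := hF (hG.prodMap Function.injective_id hμν)
      exact Subtype.ext (beta_inj (Subtype.mk.inj this))
    have := Nat.card_le_card_of_injective H hH
    simpa [Nat.card_prod] using this
  · have : IsEmpty {μ : Nat.Partition n // ¬ IsTCore t μ} :=
      ⟨fun μ => h (bad_le ht (beta_mem μ.1) (beta_bad μ.2))⟩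
    simp

/-- The number of `t`-core partitions of `n` is at least `p(n) - (t+1)·p(n-t)`,
where `p(m) = 0` for `m < 0`. -/
theorem count_tcore_ge (n t : ℕ) (ht : 0 < t) :
    ((Nat.card {μ : Nat.Partition n // IsTCore t μ}) : ℤ) ≥
      (Nat.card (Nat.Partition n) : ℤ) -
        (t + 1) * (if t ≤ n then (Nat.card (Nat.Partition (n - t)) : ℤ) else 0) := by
  classical
  have h1 := card_noncore_le n t ht
  have h2 : Nat.card {μ : Nat.Partition n // IsTCore t μ} +
      Nat.card {μ : Nat.Partition n // ¬ IsTCore t μ} = Nat.card (Nat.Partition n) := by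
    rw [← Nat.card_sum]
    exact Nat.card_congr (Equiv.sumCompl _)
  have h3 : ((Nat.card {μ : Nat.Partition n // ¬ IsTCore t μ} : ℕ) : ℤ) ≤
      (t + 1) * (if t ≤ n then (Nat.card (Nat.Partition (n - t)) : ℤ) else 0) := by
    have := (Int.ofNat_le.mpr h1)
    push_cast at this
    linarith
  rw [← h2]
  push_cast
  linarith
end

section
/- There exist constants c, C > 0 such that for all n ≥ 1, the partition function p(n) satisfies |p(n) − e^{π√(2n/3)}/(4√3 n)| ≤ C·n^{-1/2}·e^{π√(2n/3)}/(4√3 n); in particular p(n) = (1+O(n^{-1/2}))·e^{π√(2n/3)}/(4√3 n). -/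
open Real

namespace PA

/-- the number of partitions -/
noncomputable def pc (n : ℕ) : ℕ := Nat.card (Nat.Partition n)

section gen
open PowerSeries
open scoped PowerSeries.WithPiTopology

/-- the series `1/(1-X^(i+1))` -/
noncomputable def fac (i : ℕ) : PowerSeries ℕ :=
  PowerSeries.mk fun n => if (i + 1) ∣ n then 1 else 0

lemma hasSum_fac (i : ℕ) : HasSum (fun j : ℕ => (X : PowerSeries ℕ) ^ ((i + 1) * j)) (fac i) := by
  rw [PowerSeries.WithPiTopology.hasSum_iff_hasSum_coeff]
  intro d
  simp only [coeff_X_pow, fac, coeff_mk]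
  by_cases h : (i + 1) ∣ d
  · obtain ⟨k, rfl⟩ := h
    have : (fun j : ℕ => if (i + 1) * k = (i + 1) * j then (1:ℕ) else 0)
        = fun j => if j = k then 1 else 0 := by
      ext j
      have : (i + 1) * k = (i + 1) * j ↔ j = k := by
        rw [Nat.mul_right_inj (by omega)]; exact eq_comm
      simp [this]
    rw [this]
    simpa using hasSum_ite_eq k (1:ℕ)
  · have : (fun j : ℕ => if d = (i + 1) * j then (1:ℕ) else 0) = fun j => 0 := by
      ext j
      rw [if_neg]
      rintro rfl
      exact h (dvd_mul_right _ _)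
    rw [this, if_neg h]
    exact hasSum_zero

lemma hasProd_fac : HasProd fac (PowerSeries.mk pc) := by
  have := Nat.Partition.hasProd_powerSeriesMk_card_restricted ℕ (fun _ => True)
  simp only [if_true] at this
  convert this using 1
  · ext1 i
    exact ((hasSum_fac i).tsum_eq).symm
  · ext n
    simp [pc, Nat.Partition.restricted, Nat.card_eq_fintype_card]

/-- coefficients of the finite products -/
noncomputable def pk (K n : ℕ) : ℕ := coeff n (∏ i ∈ Finset.range K, fac i)

lemma pk_eventually (n : ℕ) : ∀ᶠ K in Filter.atTop, pk K n = pc n := by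
  have h := hasProd_fac.tendsto_prod_nat
  rw [PowerSeries.WithPiTopology.tendsto_iff_coeff_tendsto] at h
  have := h n
  simp only [coeff_mk] at this
  rw [nhds_discrete, Filter.tendsto_pure] at this
  exact this

lemma pk_mono (n : ℕ) : Monotone fun K => pk K n := by
  apply monotone_nat_of_le_succ
  intro K
  simp only [pk, Finset.prod_range_succ, coeff_mul]
  have : (n, 0) ∈ Finset.HasAntidiagonal.antidiagonal n := by simp
  refine le_trans ?_ (Finset.single_le_sum (f := fun p : ℕ × ℕ =>
    coeff p.1 (∏ i ∈ Finset.range K, fac i) * coeff p.2 (fac K)) (fun _ _ => Nat.zero_le _) this)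
  simp [fac]

lemma pk_le (K n : ℕ) : pk K n ≤ pc n := by
  obtain ⟨L, hL⟩ := ((pk_eventually n).and (Filter.eventually_ge_atTop K)).exists
  rw [← hL.1]
  exact pk_mono n hL.2

lemma fac_hasSum {q : ℂ} (hq : ‖q‖ < 1) (i : ℕ) :
    (Summable fun n => ‖((coeff n (fac i) : ℕ) : ℂ) * q ^ n‖) ∧
    ∑' n, ((coeff n (fac i) : ℕ) : ℂ) * q ^ n = (1 - q ^ (i + 1))⁻¹ := by
  have h1 : Summable fun n => ‖((coeff n (fac i) : ℕ) : ℂ) * q ^ n‖ := by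
    refine Summable.of_nonneg_of_le (fun _ => norm_nonneg _) (fun n => ?_)
      (summable_geometric_of_lt_one (norm_nonneg q) hq)
    simp only [fac, coeff_mk, norm_mul, norm_pow]
    split_ifs <;> simp
  refine ⟨h1, ?_⟩
  have hinj : Function.Injective fun j : ℕ => (i + 1) * j := fun a b h =>
    Nat.eq_of_mul_eq_mul_left (by omega) h
  rw [← hinj.tsum_eq (f := fun n => ((coeff n (fac i) : ℕ) : ℂ) * q ^ n)]
  · simp only [fac, coeff_mk, dvd_mul_right, if_true, Nat.cast_one, one_mul, pow_mul]
    apply tsum_geometric_of_norm_lt_one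
    rw [norm_pow]
    exact pow_lt_one₀ (norm_nonneg _) hq (by omega)
  · intro n hn
    simp only [fac, coeff_mk, Function.mem_support] at hn
    by_cases h : (i + 1) ∣ n
    · obtain ⟨k, rfl⟩ := h
      exact ⟨k, rfl⟩
    · simp [h] at hn

lemma pk_hasSum {q : ℂ} (hq : ‖q‖ < 1) (K : ℕ) :
    (Summable fun n => ‖(pk K n : ℂ) * q ^ n‖) ∧
    ∑' n, (pk K n : ℂ) * q ^ n = ∏ i ∈ Finset.range K, (1 - q ^ (i + 1))⁻¹ := by
  induction K with
  | zero =>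
    have : ∀ n, (pk 0 n : ℂ) * q ^ n = if n = 0 then 1 else 0 := by
      intro n
      simp only [pk, Finset.range_zero, Finset.prod_empty, coeff_one]
      split_ifs with h <;> simp [h]
    simp only [this]
    refine ⟨?_, by simp⟩
    apply summable_of_ne_finset_zero (s := {0})
    intro b hb
    simp at hb
    simp [hb]
  | succ K ih =>
    obtain ⟨h1, h2⟩ := ih
    obtain ⟨h3, h4⟩ := fac_hasSum hq K
    have key : ∀ n, (pk (K + 1) n : ℂ) * q ^ n = ∑ kl ∈ Finset.HasAntidiagonal.antidiagonal n,
        ((pk K kl.1 : ℂ) * q ^ kl.1) * (((coeff kl.2 (fac K) : ℕ) : ℂ) * q ^ kl.2) := by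
      intro n
      simp only [pk, Finset.prod_range_succ, coeff_mul]
      push_cast
      rw [Finset.sum_mul]
      refine Finset.sum_congr rfl fun kl hkl => ?_
      rw [← Finset.HasAntidiagonal.mem_antidiagonal.mp hkl, pow_add]
      ring
    have t1 := summable_norm_sum_mul_antidiagonal_of_summable_norm h1 h3
    have t2 := tsum_mul_tsum_eq_tsum_sum_antidiagonal_of_summable_norm h1 h3
    rw [h2, h4] at t2
    rw [Finset.prod_range_succ, t2]
    refine ⟨?_, tsum_congr key⟩
    exact t1.congr fun n => (congrArg norm (key n)).symm

lemma prod_bound {s : ℝ} (hs : 0 < s) (K : ℕ) :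
    ∏ i ∈ Finset.range K, (1 - exp (-s) ^ (i + 1))⁻¹ ≤ exp (π ^ 2 / (6 * s)) := by
  have hr0 : 0 < exp (-s) := exp_pos _
  have hr1 : exp (-s) < 1 := by simpa using hs
  set r := exp (-s) with hr
  have hpos : ∀ i : ℕ, 0 < 1 - r ^ (i + 1) := fun i =>
    sub_pos.mpr (pow_lt_one₀ hr0.le hr1 (by omega))
  have e : ∏ i ∈ Finset.range K, (1 - r ^ (i + 1))⁻¹
      = exp (∑ i ∈ Finset.range K, -Real.log (1 - r ^ (i + 1))) := by
    rw [exp_sum]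
    refine Finset.prod_congr rfl fun i _ => ?_
    rw [exp_neg, exp_log (hpos i)]
  rw [e, exp_le_exp]
  have h1 : HasSum (fun m : ℕ => ∑ i ∈ Finset.range K, (r ^ (i + 1)) ^ (m + 1) / ((m : ℝ) + 1))
      (∑ i ∈ Finset.range K, -Real.log (1 - r ^ (i + 1))) := by
    apply hasSum_sum
    intro i _
    apply Real.hasSum_pow_div_log_of_abs_lt_one
    rw [abs_of_pos (by positivity)]
    linarith [hpos i]
  have h2 : HasSum (fun m : ℕ => 1 / (((m + 1 : ℕ) : ℝ)) ^ 2 * (1 / s)) (π ^ 2 / 6 * (1 / s)) := by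
    apply HasSum.mul_right
    have := (hasSum_nat_add_iff' 1).mpr hasSum_zeta_two
    simpa using this
  have h3 := hasSum_le (fun m => ?_) h1 h2
  · refine h3.trans_eq ?_
    rw [mul_one_div, div_div]
  · rw [← Finset.sum_div]
    have hm : (0:ℝ) < (m:ℝ) + 1 := by positivity
    have hR1 : r ^ (m + 1) < 1 := by linarith [hpos m]
    have hR0 : 0 < r ^ (m + 1) := by positivity
    have hsum : ∑ i ∈ Finset.range K, (r ^ (i + 1)) ^ (m + 1) ≤ 1 / ((m + 1) * s) := by
      have a1 : ∑ i ∈ Finset.range K, (r ^ (i + 1)) ^ (m + 1)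
          = r ^ (m + 1) * ∑ i ∈ Finset.range K, (r ^ (m + 1)) ^ i := by
        rw [Finset.mul_sum]
        refine Finset.sum_congr rfl fun i _ => ?_
        rw [← pow_mul, ← pow_mul, ← pow_add]
        ring_nf
      have a2 : ∑ i ∈ Finset.range K, (r ^ (m + 1)) ^ i ≤ (1 - r ^ (m + 1))⁻¹ := by
        have := (hasSum_geometric_of_lt_one hR0.le hR1)
        exact sum_le_hasSum _ (fun _ _ => by positivity) this
      have a3 : r ^ (m + 1) * (1 + (m + 1) * s) ≤ 1 := by
        have : r ^ (m + 1) = exp (-((m + 1) * s)) := by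
          rw [hr, ← exp_nat_mul]; push_cast; ring_nf
        rw [this]
        have b := add_one_le_exp ((m + 1) * s)
        calc exp (-((m + 1) * s)) * (1 + (m + 1) * s)
            ≤ exp (-((m + 1) * s)) * exp ((m + 1) * s) := by
              gcongr; linarith
          _ = 1 := by rw [← exp_add]; simp
      rw [a1]
      calc r ^ (m + 1) * ∑ i ∈ Finset.range K, (r ^ (m + 1)) ^ i
          ≤ r ^ (m + 1) * (1 - r ^ (m + 1))⁻¹ := by gcongr
        _ ≤ 1 / ((m + 1) * s) := by
          rw [← div_eq_mul_inv, div_le_div_iff₀ (by linarith) (by positivity)]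
          nlinarith
    calc _ ≤ (1 / ((m + 1) * s)) / ((m:ℝ) + 1) := by gcongr
      _ = _ := by push_cast; field_simp

lemma pc_sum {s : ℝ} (hs : 0 < s) :
    (Summable fun n => (pc n : ℝ) * exp (-s) ^ n) ∧
    ∑' n, (pc n : ℝ) * exp (-s) ^ n ≤ exp (π ^ 2 / (6 * s)) := by
  have hr0 : 0 < exp (-s) := exp_pos _
  have hr1 : exp (-s) < 1 := by simpa using hs
  have hb : ∀ N, ∑ n ∈ Finset.range N, (pc n : ℝ) * exp (-s) ^ n ≤ exp (π ^ 2 / (6 * s)) := by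
    intro N
    obtain ⟨K, hK⟩ := ((Filter.eventually_all_finset (Finset.range N)).mpr
      (fun n _ => pk_eventually n)).exists
    have hq : ‖(exp (-s) : ℂ)‖ < 1 := by
      rw [Complex.norm_real,
        Real.norm_of_nonneg hr0.le]; exact hr1
    obtain ⟨h1, h2⟩ := pk_hasSum hq K
    have h3 : ((∑' n, (pk K n : ℝ) * exp (-s) ^ n : ℝ) : ℂ)
        = ((∏ i ∈ Finset.range K, (1 - exp (-s) ^ (i + 1))⁻¹ : ℝ) : ℂ) := by
      push_cast
      simpa using h2
    have h4 := Complex.ofReal_injective h3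
    have h5 : Summable fun n => (pk K n : ℝ) * exp (-s) ^ n := by
      convert h1 using 2 with n
      rw [norm_mul, norm_pow, Complex.norm_real,
        Real.norm_of_nonneg hr0.le]
      simp
    refine le_trans ?_ (prod_bound hs K)
    rw [← h4]
    rw [Finset.sum_congr rfl (fun n hn => by rw [← hK n hn])]
    exact h5.sum_le_tsum _ (fun _ _ => by positivity)
  refine ⟨summable_of_sum_range_le (fun _ => by positivity) hb,
    Real.tsum_le_of_sum_range_le (fun _ => by positivity) hb⟩

lemma pc_summable {r : ℝ} (h0 : 0 ≤ r) (h1 : r < 1) : Summable fun n => (pc n : ℝ) * r ^ n := by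
  rcases h0.eq_or_lt with rfl | h0
  · apply summable_of_ne_finset_zero (s := {0})
    intro b hb
    simp at hb
    simp [hb]
  · have := (pc_sum (s := -Real.log r) (by simpa using Real.log_neg h0 h1)).1
    simpa [exp_log h0] using this

/-- the generating function -/
noncomputable def PP (q : ℂ) : ℂ := ∑' n, (pc n : ℂ) * q ^ n

lemma PP_summable {q : ℂ} (hq : ‖q‖ < 1) : Summable fun n => (pc n : ℂ) * q ^ n := by
  apply Summable.of_norm
  simpa using pc_summable (norm_nonneg q) hq

lemma PP_eq {q : ℂ} (hq : ‖q‖ < 1) : PP q * ∏' n : ℕ, (1 - q ^ (n + 1)) = 1 := by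
  have h1 : Filter.Tendsto (fun K => ∑' n, (pk K n : ℂ) * q ^ n) Filter.atTop (nhds (PP q)) := by
    apply tendsto_tsum_of_dominated_convergence (pc_summable (norm_nonneg q) hq)
    · intro n
      apply tendsto_nhds_of_eventually_eq
      filter_upwards [pk_eventually n] with K hK
      rw [hK]
    · refine Filter.Eventually.of_forall fun K n => ?_
      simp only [norm_mul, norm_pow, Complex.norm_natCast]
      have : (pk K n : ℝ) ≤ pc n := by exact_mod_cast pk_le K n
      gcongr
  have h2 := (ModularForm.multipliable_one_sub_pow hq).hasProd.tendsto_prod_nat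
  have h3 := h1.mul h2
  refine tendsto_nhds_unique h3 ?_
  apply tendsto_nhds_of_eventually_eq
  refine Filter.Eventually.of_forall fun K => ?_
  rw [(pk_hasSum hq K).2, ← Finset.prod_mul_distrib]
  apply Finset.prod_eq_one
  intro i _
  apply inv_mul_cancel₀
  intro h
  have : q ^ (i + 1) = 1 := (sub_eq_zero.mp h).symm
  have h' : ‖q‖ ^ (i + 1) = 1 := by rw [← norm_pow, this, norm_one]
  exact absurd h' (pow_lt_one₀ (norm_nonneg _) hq (by omega)).ne

end gen
end PA

namespace PA

lemma norm_exp_neg_lt {w : ℂ} (hw : 0 < w.re) : ‖Complex.exp (-w)‖ < 1 := by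
  rw [Complex.norm_exp]; simpa using hw

lemma PP_norm_le {w : ℂ} (hw : 0 < w.re) :
    ‖PP (Complex.exp (-w))‖ ≤ exp (π ^ 2 / (6 * w.re)) := by
  have h := pc_sum hw
  refine le_trans ?_ h.2
  refine tsum_of_norm_bounded h.1.hasSum fun n => ?_
  rw [norm_mul, norm_pow, Complex.norm_exp]
  simp

lemma PP_sub_one {w : ℂ} (hw : 0 < w.re) :
    ‖PP (Complex.exp (-w)) - 1‖ ≤ exp (-(w.re / 2)) * exp (π ^ 2 / (3 * w.re)) := by
  have h := pc_sum (s := w.re / 2) (by linarith)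
  have h0 : pc 0 = 1 := by simp [pc]
  have e : PP (Complex.exp (-w)) - 1 = ∑' n, (pc (n + 1) : ℂ) * Complex.exp (-w) ^ (n + 1) := by
    rw [PP, (PP_summable (norm_exp_neg_lt hw)).tsum_eq_zero_add]
    simp [h0]
  rw [e]
  have h1 := (summable_nat_add_iff 1).mpr h.1
  have h2 : ∑' n : ℕ, (pc (n + 1) : ℝ) * exp (-(w.re / 2)) ^ (n + 1) ≤ exp (π ^ 2 / (3 * w.re)) := by
    have h3 := h.1.tsum_eq_zero_add
    have h4 := h.2
    rw [h3] at h4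
    have : π ^ 2 / (6 * (w.re / 2)) = π ^ 2 / (3 * w.re) := by ring_nf
    rw [this] at h4
    have : (0:ℝ) ≤ (pc 0 : ℝ) * exp (-(w.re / 2)) ^ 0 := by positivity
    linarith
  have h5 := h1.hasSum.mul_left (exp (-(w.re / 2)))
  refine (tsum_of_norm_bounded h5 fun n => ?_).trans (by gcongr)
  rw [norm_mul, norm_pow, Complex.norm_exp, Complex.norm_natCast, Complex.neg_re]
  have : exp (-w.re) ^ (n + 1) = exp (-(w.re / 2)) ^ (n + 1) * exp (-(w.re / 2)) ^ (n + 1) := by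
    rw [← mul_pow, ← exp_add]; ring_nf
  rw [this]
  have h6 : exp (-(w.re / 2)) ^ (n + 1) ≤ exp (-(w.re / 2)) := by
    apply pow_le_of_le_one (exp_pos _).le _ (by omega)
    simp; linarith
  calc _ = exp (-(w.re / 2)) ^ (n + 1) * ((pc (n + 1) : ℝ) * exp (-(w.re / 2)) ^ (n + 1)) := by ring
    _ ≤ _ := by gcongr

lemma PP_continuous {x : ℝ} (hx : 0 < x) :
    Continuous fun θ : ℝ => PP (Complex.exp (-(x + θ * Complex.I))) := by
  apply continuous_tsum (u := fun n => (pc n : ℝ) * exp (-x) ^ n)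
  · intro n; fun_prop
  · exact (pc_sum hx).1
  · intro n θ
    rw [norm_mul, norm_pow, Complex.norm_exp]
    simp

lemma integral_exp_int (k : ℤ) (hk : k ≠ 0) :
    ∫ θ in (-π)..π, Complex.exp (((k : ℂ) * Complex.I) * θ) = 0 := by
  rw [integral_exp_mul_complex (by simpa using hk)]
  have : Complex.exp (((k : ℂ) * Complex.I) * (π : ℝ))
      = Complex.exp (((k : ℂ) * Complex.I) * ((-π : ℝ))) := by
    rw [Complex.exp_eq_exp_iff_exists_int]
    exact ⟨k, by push_cast; ring⟩
  rw [this]; simp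

lemma cauchy {x : ℝ} (hx : 0 < x) (n : ℕ) :
    ∫ θ in (-π)..π, PP (Complex.exp (-(x + θ * Complex.I))) *
      Complex.exp (n * (x + θ * Complex.I)) = 2 * π * pc n := by
  set F : ℕ → ℝ → ℂ := fun m θ => (pc m : ℂ) * Complex.exp (-(x + θ * Complex.I)) ^ m *
      Complex.exp (n * (x + θ * Complex.I)) with hF
  have h := intervalIntegral.hasSum_integral_of_dominated_convergence (a := -π) (b := π)
    (μ := MeasureTheory.volume) (F := F)
    (f := fun θ => PP (Complex.exp (-(x + θ * Complex.I))) *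
      Complex.exp (n * (x + θ * Complex.I)))
    (fun m _ => (pc m : ℝ) * exp (-x) ^ m * exp (n * x)) ?_ ?_ ?_ ?_ ?_
  · have hv : ∀ m, ∫ θ in (-π)..π, F m θ = if m = n then 2 * π * (pc n : ℂ) else 0 := by
      intro m
      have e : ∀ θ : ℝ, F m θ = ((pc m : ℂ) * Complex.exp ((n - m) * x)) *
          Complex.exp ((((n - m : ℤ) : ℂ) * Complex.I) * θ) := by
        intro θ
        simp only [hF]
        rw [← Complex.exp_nat_mul, mul_assoc, mul_assoc, ← Complex.exp_add, ← Complex.exp_add]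
        congr 2
        push_cast
        ring
      simp only [e]
      rw [intervalIntegral.integral_const_mul]
      split_ifs with hm
      · subst hm
        simp
        ring
      · rw [integral_exp_int _ (by omega)]; simp
    simp only [hv] at h
    exact h.unique (hasSum_ite_eq n _)
  · intro m
    apply Continuous.aestronglyMeasurable
    simp only [hF]
    fun_prop
  · intro m
    refine Filter.Eventually.of_forall fun θ _ => ?_
    simp only [hF]
    rw [norm_mul, norm_mul, norm_pow, Complex.norm_exp, Complex.norm_exp]
    simp
  · refine Filter.Eventually.of_forall fun θ _ => ?_
    exact (pc_sum hx).1.mul_right _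
  · exact intervalIntegrable_const
  · refine Filter.Eventually.of_forall fun θ _ => ?_
    apply HasSum.mul_right
    exact (PP_summable (norm_exp_neg_lt (by simpa using hx))).hasSum

lemma eta_PP {z : ℂ} (hz : 0 < z.im) :
    ModularForm.eta z * PP (Complex.exp (2 * π * Complex.I * z))
      = Complex.exp (2 * π * Complex.I * z / 24) := by
  have h1 : ‖Complex.exp (2 * π * Complex.I * z)‖ < 1 := by
    rw [Complex.norm_exp]
    simp
    positivity
  have h2 := PP_eq h1
  simp only [ModularForm.eta, ModularForm.eta_q_eq_pow]
  rw [mul_assoc, mul_comm (∏' _, _), h2, mul_one, Function.Periodic.qParam]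
  simp

lemma transform {t : ℂ} (ht : 0 < t.re) :
    PP (Complex.exp (-t)) = Complex.exp (-t / 24) * Complex.sqrt (t / (2 * π)) *
      Complex.exp (π ^ 2 / (6 * t)) * PP (Complex.exp (-(4 * π ^ 2 / t))) := by
  have ht0 : t ≠ 0 := by rintro rfl; simp at ht
  have hpi : (π : ℂ) ≠ 0 := by exact_mod_cast pi_ne_zero
  have hI := Complex.I_ne_zero
  set z : ℂ := Complex.I * (t / (2 * π)) with hz
  have hre : (t / (2 * π)).re = t.re / (2 * π) := by
    have : t / (2 * π) = t / ((2 * π : ℝ) : ℂ) := by push_cast; rfl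
    rw [this, Complex.div_ofReal_re]
  have hre' : 0 < (t / (2 * π)).re := by rw [hre]; positivity
  have hzim : 0 < z.im := by
    rw [hz, Complex.mul_im]; simpa using hre'
  have hz0 : z ≠ 0 := by rintro h; simp [h] at hzim
  have hz' : 0 < (-1 / z).im := by
    rw [neg_div, one_div, Complex.neg_im, Complex.inv_im]
    have := Complex.normSq_pos.mpr hz0
    rw [neg_div, neg_neg]
    positivity
  have h1 := ModularForm.eta_comp_eq_csqrt_I_inv (x := z) hzim
  simp only [Function.comp, Pi.smul_apply, Pi.mul_apply, smul_eq_mul] at h1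
  have e1 := eta_PP hzim
  have e2 := eta_PP hz'
  have a1 : 2 * π * Complex.I * z = -t := by
    rw [hz]; field_simp; rw [Complex.I_sq]
  have a2 : 2 * π * Complex.I * (-1 / z) = -(4 * π ^ 2 / t) := by
    rw [hz]; field_simp; ring
  rw [a1] at e1
  rw [a2, h1] at e2
  have hs : Complex.sqrt z = Complex.sqrt Complex.I * Complex.sqrt (t / (2 * π)) := by
    have htp : t / (2 * π) ≠ 0 := by rintro h; simp [h] at hre'
    have harg := (Complex.abs_arg_lt_pi_div_two_iff (z := t / (2 * π))).mpr (Or.inl hre')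
    rw [abs_lt] at harg
    simp only [Complex.sqrt]
    rw [Complex.cpow_def_of_ne_zero hz0, Complex.cpow_def_of_ne_zero hI,
      Complex.cpow_def_of_ne_zero htp, ← Complex.exp_add, ← add_mul, hz, Complex.log_mul hI htp]
    rw [Complex.arg_I]
    constructor <;> linarith [pi_pos]
  have hsI : Complex.sqrt Complex.I ≠ 0 := by
    simp only [Complex.sqrt]
    rw [Complex.cpow_def_of_ne_zero hI]
    exact Complex.exp_ne_zero _
  rw [hs] at e2
  have e3 : Complex.sqrt (t / (2 * π)) * ModularForm.eta z *
      PP (Complex.exp (-(4 * π ^ 2 / t))) = Complex.exp (-(4 * π ^ 2 / t) / 24) := by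
    rw [← e2]; field_simp
  have hη := ModularForm.eta_ne_zero (z := z) hzim
  have e4 : Complex.exp (π ^ 2 / (6 * t)) * Complex.exp (-(4 * π ^ 2 / t) / 24) = 1 := by
    rw [← Complex.exp_add]
    convert Complex.exp_zero using 2
    field_simp; ring
  apply mul_left_cancel₀ hη
  rw [e1]
  calc Complex.exp (-t / 24) = Complex.exp (-t / 24) *
        (Complex.exp (π ^ 2 / (6 * t)) * Complex.exp (-(4 * π ^ 2 / t) / 24)) := by rw [e4, mul_one]
    _ = _ := by rw [← e3]; ring

end PA

namespace PA

lemma csqrt_sq (w : ℂ) : Complex.sqrt w ^ 2 = w := by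
  simp only [Complex.sqrt]
  have := Complex.cpow_nat_inv_pow w (n := 2) (by norm_num)
  exact_mod_cast this

lemma csqrt_norm_sq (w : ℂ) : ‖Complex.sqrt w‖ ^ 2 = ‖w‖ := by
  rw [← norm_pow, csqrt_sq]

lemma csqrt_norm_le_one {w : ℂ} (hw : ‖w‖ ≤ 1) : ‖Complex.sqrt w‖ ≤ 1 := by
  have := csqrt_norm_sq w
  nlinarith [norm_nonneg (Complex.sqrt w)]

lemma csqrt_real_mul {a : ℝ} (ha : 0 < a) {w : ℂ} (hw : w ≠ 0) :
    Complex.sqrt (a * w) = (√a : ℝ) * Complex.sqrt w := by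
  have ha' : (a : ℂ) ≠ 0 := by exact_mod_cast ha.ne'
  simp only [Complex.sqrt]
  rw [Complex.cpow_def_of_ne_zero (mul_ne_zero ha' hw), Complex.cpow_def_of_ne_zero hw,
    Complex.log_ofReal_mul ha hw, add_mul, Complex.exp_add]
  congr 1
  rw [Real.sqrt_eq_rpow, Complex.ofReal_cpow ha.le, Complex.cpow_def_of_ne_zero ha',
    Complex.ofReal_log ha.le]
  norm_num

lemma csqrt_re_nonneg (w : ℂ) : 0 ≤ (Complex.sqrt w).re := by
  by_cases hw : w = 0
  · simp [hw, Complex.sqrt]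
  simp only [Complex.sqrt]
  rw [Complex.cpow_def_of_ne_zero hw, Complex.exp_re]
  apply mul_nonneg (exp_pos _).le
  have e : (Complex.log w * 2⁻¹).im = w.arg / 2 := by
    have : (2⁻¹ : ℂ) = ((2⁻¹ : ℝ) : ℂ) := by push_cast; rfl
    rw [this, Complex.im_mul_ofReal, Complex.log_im]; ring
  rw [e]
  apply cos_nonneg_of_neg_pi_div_two_le_of_le
  · linarith [Complex.neg_pi_lt_arg w]
  · linarith [Complex.arg_le_pi w]

lemma csqrt_taylor (w : ℂ) : ‖Complex.sqrt (1 + w) - 1 - w / 2‖ ≤ ‖w‖ ^ 2 / 2 := by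
  set s := Complex.sqrt (1 + w) with hs
  have h1 : s ^ 2 = 1 + w := csqrt_sq _
  have h2 : 1 ≤ ‖s + 1‖ := by
    refine le_trans ?_ (Complex.re_le_norm _)
    have := csqrt_re_nonneg (1 + w)
    rw [Complex.add_re, Complex.one_re, hs]; linarith
  have h3 : ‖s - 1‖ ≤ ‖w‖ := by
    have : w = (s - 1) * (s + 1) := by linear_combination -h1
    rw [this, norm_mul]
    nlinarith [norm_nonneg (s - 1)]
  have h4 : s - 1 - w / 2 = -(s - 1) ^ 2 / 2 := by linear_combination (1/2 : ℂ) * h1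
  rw [h4, norm_div, norm_neg, norm_pow]
  have : ‖(2:ℂ)‖ = 2 := by simp
  rw [this]
  gcongr

/-- main term on the major arc -/
noncomputable def mainF (n : ℕ) (t : ℂ) : ℂ :=
  Complex.exp (-t / 24) * Complex.sqrt (t / (2 * π)) * Complex.exp (π ^ 2 / (6 * t)) *
    Complex.exp (n * t)

lemma G_eq {t : ℂ} (ht : 0 < t.re) (n : ℕ) :
    PP (Complex.exp (-t)) * Complex.exp (n * t) = mainF n t *
      PP (Complex.exp (-(4 * π ^ 2 / t))) := by
  rw [transform ht, mainF]; ring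

lemma re_div (a : ℝ) (x θ : ℝ) :
    ((a : ℂ) / (x + θ * Complex.I)).re = a * x / (x ^ 2 + θ ^ 2) := by
  rw [Complex.div_re]
  simp [Complex.normSq_apply]
  ring_nf

lemma mainF_norm {n : ℕ} {x θ : ℝ} (hx : 0 < x) (hx' : x ≤ π) (hθ : |θ| ≤ π) :
    ‖mainF n (x + θ * Complex.I)‖ ≤ exp (-x / 24 + π ^ 2 / 6 * x / (x ^ 2 + θ ^ 2) + n * x) := by
  rw [mainF, norm_mul, norm_mul, norm_mul, Complex.norm_exp, Complex.norm_exp, Complex.norm_exp]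
  have h1 : ‖Complex.sqrt ((x + θ * Complex.I) / (2 * π))‖ ≤ 1 := by
    apply csqrt_norm_le_one
    rw [norm_div, norm_mul]
    have : ‖(π : ℂ)‖ = π := by rw [Complex.norm_real, Real.norm_of_nonneg pi_pos.le]
    rw [this, div_le_one (by simp [pi_pos])]
    refine (norm_add_le _ _).trans ?_
    simp only [norm_mul, Complex.norm_I, mul_one, Complex.norm_real, Real.norm_eq_abs,
      abs_of_pos hx]
    simp
    linarith
  have e1 : (-(x + θ * Complex.I) / 24).re = -x / 24 := by
    have : (-((x:ℂ) + θ * Complex.I) / 24) = -((x:ℂ) + θ * Complex.I) / ((24:ℝ) : ℂ) := by norm_num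
    rw [this, Complex.div_ofReal_re]; simp
  have e2 : ((π : ℂ) ^ 2 / (6 * (x + θ * Complex.I))).re = π ^ 2 / 6 * x / (x ^ 2 + θ ^ 2) := by
    rw [← re_div]; congr 1; push_cast; rw [div_div]
  have e3 : ((n : ℂ) * (x + θ * Complex.I)).re = n * x := by simp
  rw [e1, e2, e3, exp_add, exp_add]
  gcongr
  exact mul_le_of_le_one_right (exp_pos _).le h1

lemma minor {n : ℕ} {x θ : ℝ} (hx : 0 < x) (hx' : x ≤ π) (h1 : x ≤ |θ|) (hθ : |θ| ≤ π) :
    ‖PP (Complex.exp (-(x + θ * Complex.I))) * Complex.exp (n * (x + θ * Complex.I))‖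
      ≤ exp (n * x + 3 / 4 * (π ^ 2 / 6 / x)) := by
  have ht : 0 < ((x : ℂ) + θ * Complex.I).re := by simpa using hx
  rw [G_eq ht, norm_mul]
  have hre : ((4 * (π : ℂ) ^ 2) / (x + θ * Complex.I)).re = 4 * π ^ 2 * x / (x ^ 2 + θ ^ 2) := by
    rw [← re_div]; push_cast; rfl
  have hu : 0 < x ^ 2 + θ ^ 2 := by positivity
  have h2 := PP_norm_le (w := (4 * (π : ℂ) ^ 2) / (x + θ * Complex.I)) (by rw [hre]; positivity)
  rw [hre] at h2
  refine (mul_le_mul (mainF_norm hx hx' hθ) h2 (norm_nonneg _) (exp_pos _).le).trans ?_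
  rw [← exp_add, exp_le_exp]
  have hθ2 : x ^ 2 ≤ θ ^ 2 := by rw [← sq_abs θ]; gcongr
  have hθ3 : θ ^ 2 ≤ π ^ 2 := by rw [← sq_abs θ]; gcongr
  have b1 : π ^ 2 / 6 * x / (x ^ 2 + θ ^ 2) ≤ 1 / 2 * (π ^ 2 / 6 / x) := by
    rw [div_le_iff₀ hu]
    have : 1 / 2 * (π ^ 2 / 6 / x) * (x ^ 2 + θ ^ 2) - π ^ 2 / 6 * x
        = (π ^ 2 / 12 / x) * (θ ^ 2 - x ^ 2) := by field_simp; ring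
    have : 0 ≤ (π ^ 2 / 12 / x) * (θ ^ 2 - x ^ 2) := mul_nonneg (by positivity) (by linarith)
    linarith
  have b2 : π ^ 2 / (6 * (4 * π ^ 2 * x / (x ^ 2 + θ ^ 2))) ≤ x / 24 + 1 / 4 * (π ^ 2 / 6 / x) := by
    have : π ^ 2 / (6 * (4 * π ^ 2 * x / (x ^ 2 + θ ^ 2))) = x / 24 + θ ^ 2 / (24 * x) := by
      have := pi_ne_zero
      field_simp; ring
    rw [this]
    have : 1 / 4 * (π ^ 2 / 6 / x) = π ^ 2 / (24 * x) := by field_simp; ring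
    rw [this]
    gcongr
  linarith

lemma major {n : ℕ} {x θ : ℝ} (hx : 0 < x) (hx' : x ≤ 2) (hθ : |θ| ≤ x) :
    ‖PP (Complex.exp (-(x + θ * Complex.I))) * Complex.exp (n * (x + θ * Complex.I))
      - mainF n (x + θ * Complex.I)‖
      ≤ exp (n * x + π ^ 2 / 6 / x + 1 - 6 * (π ^ 2 / 6 / x)) := by
  have ht : 0 < ((x : ℂ) + θ * Complex.I).re := by simpa using hx
  have hxpi : x ≤ π := by linarith [pi_gt_three]
  rw [G_eq ht, ← mul_sub_one, norm_mul]
  have hre : ((4 * (π : ℂ) ^ 2) / (x + θ * Complex.I)).re = 4 * π ^ 2 * x / (x ^ 2 + θ ^ 2) := by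
    rw [← re_div]; push_cast; rfl
  have hu : 0 < x ^ 2 + θ ^ 2 := by positivity
  have hθ2 : θ ^ 2 ≤ x ^ 2 := by rw [← sq_abs θ]; gcongr
  have h2 := PP_sub_one (w := (4 * (π : ℂ) ^ 2) / (x + θ * Complex.I)) (by rw [hre]; positivity)
  rw [hre] at h2
  refine (mul_le_mul (mainF_norm hx hxpi (hθ.trans hxpi)) h2 (norm_nonneg _) (exp_pos _).le).trans ?_
  rw [← exp_add, ← exp_add, exp_le_exp]
  have b1 : π ^ 2 / 6 * x / (x ^ 2 + θ ^ 2) ≤ π ^ 2 / 6 / x := by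
    rw [div_le_div_iff₀ hu hx]
    have : 0 ≤ π ^ 2 / 6 * θ ^ 2 := by positivity
    nlinarith
  have b2 : π ^ 2 / (3 * (4 * π ^ 2 * x / (x ^ 2 + θ ^ 2))) ≤ 1 := by
    have : π ^ 2 / (3 * (4 * π ^ 2 * x / (x ^ 2 + θ ^ 2))) = (x ^ 2 + θ ^ 2) / (12 * x) := by
      have := pi_ne_zero
      field_simp; ring
    rw [this, div_le_one (by positivity)]
    nlinarith
  have b3 : 6 * (π ^ 2 / 6 / x) ≤ 4 * π ^ 2 * x / (x ^ 2 + θ ^ 2) / 2 := by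
    have : 6 * (π ^ 2 / 6 / x) = π ^ 2 / x := by field_simp
    rw [this, div_div, div_le_div_iff₀ hx (by positivity)]
    have : 0 ≤ π ^ 2 * (x ^ 2 - θ ^ 2) := mul_nonneg (by positivity) (by linarith)
    nlinarith
  linarith

lemma mainF_scale {n : ℕ} {x M : ℝ} (hx : 0 < x) (h1 : n * x = M) (h2 : π ^ 2 / 6 / x = M)
    (v : ℝ) :
    mainF n (x + (x * v : ℝ) * Complex.I) = ((√(x / (2 * π)) * exp (2 * M) : ℝ) : ℂ) *
      (Complex.exp (-(x / 24 : ℝ) * (1 + v * Complex.I)) * Complex.sqrt (1 + v * Complex.I) *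
        Complex.exp (-(M * v ^ 2 : ℝ) / (1 + v * Complex.I))) := by
  have hw : (1 + v * Complex.I : ℂ) ≠ 0 := by
    intro h
    have := congrArg Complex.re h
    simp at this
  set w : ℂ := 1 + v * Complex.I with hwd
  have hx0 : (x : ℂ) ≠ 0 := by exact_mod_cast hx.ne'
  have et : (x : ℂ) + (x * v : ℝ) * Complex.I = x * w := by rw [hwd]; push_cast; ring
  have hpi : (π : ℂ) ≠ 0 := by exact_mod_cast pi_ne_zero
  rw [et, mainF]
  have e1 : (x * w / (2 * π) : ℂ) = ((x / (2 * π) : ℝ) : ℂ) * w := by push_cast; ring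
  have e2 : Complex.exp (π ^ 2 / (6 * (x * w))) * Complex.exp (n * (x * w))
      = Complex.exp (2 * M) * Complex.exp (-(M * v ^ 2 : ℝ) / w) := by
    rw [← Complex.exp_add, ← Complex.exp_add]
    congr 1
    have c1 : (n : ℂ) * (x * w) = M * w := by rw [← h1]; push_cast; ring
    have c2 : (π : ℂ) ^ 2 / (6 * (x * w)) = M / w := by
      rw [← h2]; push_cast; field_simp
    have c3 : w ^ 2 - 2 * w + 1 = -(v:ℂ) ^ 2 := by
      rw [hwd]; ring_nf; rw [Complex.I_sq]; ring
    rw [c1, c2]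
    push_cast
    field_simp
    linear_combination (M : ℂ) * c3
  rw [e1, csqrt_real_mul (by positivity) hw, mul_assoc, e2]
  have e3 : -(x * w) / 24 = (-(x / 24 : ℝ) * w : ℂ) := by push_cast; ring
  rw [e3]
  push_cast
  ring

end PA

namespace PA

/-- the rescaled main term -/
noncomputable def HH (x M v : ℝ) : ℂ :=
  Complex.exp (-(x / 24 : ℝ) * (1 + v * Complex.I)) * Complex.sqrt (1 + v * Complex.I) *
        Complex.exp (-(M * v ^ 2 : ℝ) / (1 + v * Complex.I))

lemma one_add_norm_sq (v : ℝ) : ‖(1 + v * Complex.I : ℂ)‖ ^ 2 = 1 + v ^ 2 := by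
  rw [← Complex.normSq_eq_norm_sq, Complex.normSq_apply]
  simp; ring

lemma one_add_ne (v : ℝ) : (1 + v * Complex.I : ℂ) ≠ 0 := by
  intro h
  have := congrArg Complex.re h
  simp at this

lemma HH_approx {x M v : ℝ} (hx : 0 ≤ x) (hx2 : x ≤ 2) (hM : 0 < M) (hv : |v| ≤ 1) :
    ‖HH x M v - ((exp (-M * v ^ 2) : ℝ) : ℂ) *
      (1 + ((v / 2 + M * v ^ 3 : ℝ) : ℂ) * Complex.I)‖
      ≤ (2 * x + 128 * v ^ 2) * exp (-M * v ^ 2 / 8) := by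
  set w : ℂ := 1 + v * Complex.I with hw
  have hw0 : w ≠ 0 := one_add_ne v
  have hwn : ‖w‖ ^ 2 = 1 + v ^ 2 := one_add_norm_sq v
  have hv2 : v ^ 2 ≤ 1 := by rw [← sq_abs]; nlinarith [abs_nonneg v]
  have hwn1 : 1 ≤ ‖w‖ := by nlinarith [norm_nonneg w, sq_nonneg v]
  have hwn2 : ‖w‖ ≤ 2 := by nlinarith [norm_nonneg w]
  set u : ℝ := M * v ^ 2 with hu
  have hu0 : 0 ≤ u := by positivity
  set c : ℂ := Complex.sqrt w with hc
  have hcn : ‖c‖ ≤ 2 := by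
    have := csqrt_norm_sq w
    rw [← hc] at this
    nlinarith [norm_nonneg c]
  set E : ℂ := (M * v ^ 3 : ℝ) * Complex.I / w with hE
  have hEeq : -(u : ℝ) / w = -(u : ℂ) + E := by
    rw [hE, hu]; field_simp; rw [hw]; push_cast; ring
  have hEn : ‖E‖ = u * |v| / ‖w‖ := by
    rw [hE, norm_div, norm_mul, Complex.norm_I, Complex.norm_real, Real.norm_eq_abs, abs_mul,
      abs_of_pos hM, abs_pow, hu, ← sq_abs v]
    ring
  have hE1 : ‖E‖ ≤ u * |v| := by
    rw [hEn]; exact div_le_self (by positivity) hwn1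
  have hE2 : ‖E‖ ≤ 3 / 4 * u := by
    rw [hEn, div_le_iff₀ (by linarith)]
    have : |v| ≤ 3 / 4 * ‖w‖ := by
      have h9 : |v| ^ 2 ≤ (3 / 4 * ‖w‖) ^ 2 := by
        rw [sq_abs, mul_pow, hwn]; nlinarith
      exact (pow_le_pow_iff_left₀ (abs_nonneg v) (by positivity) two_ne_zero).mp h9
    nlinarith
  have hexpE : exp ‖E‖ ≤ exp (3 / 4 * u) := exp_le_exp.mpr hE2
  have x1 : ‖Complex.exp E‖ ≤ exp (3 / 4 * u) := (Complex.norm_exp_le_exp_norm E).trans hexpE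
  have x2 : ‖Complex.exp E - 1‖ ≤ ‖E‖ * exp (3 / 4 * u) := by
    have := Complex.norm_exp_sub_sum_le_norm_mul_exp E 1
    simp at this
    exact this.trans (by gcongr)
  have x3 : ‖Complex.exp E - 1 - E‖ ≤ ‖E‖ ^ 2 * exp (3 / 4 * u) := by
    have := Complex.norm_exp_sub_sum_le_norm_mul_exp E 2
    simp [Finset.sum_range_succ] at this
    rw [sub_sub]
    exact this.trans (by gcongr)
  have x4 : ‖E - (M * v ^ 3 : ℝ) * Complex.I‖ ≤ u * v ^ 2 := by
    have : E - (M * v ^ 3 : ℝ) * Complex.I = ((u * v ^ 2 : ℝ) : ℂ) / w := by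
      rw [hE, hu]; field_simp; rw [hw]; push_cast; ring_nf; rw [Complex.I_sq]; ring
    rw [this, norm_div, Complex.norm_real, Real.norm_of_nonneg (by positivity)]
    exact div_le_self (by positivity) hwn1
  have x5 : ‖c - 1 - v * Complex.I / 2‖ ≤ v ^ 2 / 2 := by
    have := csqrt_taylor (v * Complex.I)
    rw [← hw, ← hc] at this
    simpa using this
  have y1 : ‖Complex.exp (-(x / 24 : ℝ) * w) - 1‖ ≤ x := by
    have hn : ‖(-(x / 24 : ℝ) * w : ℂ)‖ ≤ x / 12 := by
      rw [norm_mul, norm_neg, Complex.norm_real, Real.norm_of_nonneg (by positivity)]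
      nlinarith
    have := Complex.norm_exp_sub_one_le (x := (-(x / 24 : ℝ) * w : ℂ)) (by linarith)
    linarith
  have eH : HH x M v = Complex.exp (-(x / 24 : ℝ) * w) * c *
      (((exp (-u) : ℝ) : ℂ) * Complex.exp E) := by
    rw [HH, ← hw, ← hc, ← hu, hEeq, Complex.exp_add]
    push_cast; rfl
  have e0 : -M * v ^ 2 = -u := by rw [hu]; ring
  rw [eH, e0]
  have split : Complex.exp (-(x / 24 : ℝ) * w) * c * (((exp (-u) : ℝ) : ℂ) * Complex.exp E)
      - ((exp (-u) : ℝ) : ℂ) * (1 + ((v / 2 + M * v ^ 3 : ℝ) : ℂ) * Complex.I)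
      = ((exp (-u) : ℝ) : ℂ) * ((Complex.exp (-(x / 24 : ℝ) * w) - 1) * c * Complex.exp E
        + (c - 1 - v * Complex.I / 2) * Complex.exp E
        + (Complex.exp E - 1 - E) + (E - (M * v ^ 3 : ℝ) * Complex.I)
        + (v * Complex.I / 2) * (Complex.exp E - 1)) := by
    push_cast; ring
  rw [split, norm_mul, Complex.norm_real, Real.norm_of_nonneg (exp_pos _).le]
  set Q := exp (3 / 4 * u) with hQ
  have hQ1 : 1 ≤ Q := one_le_exp (by positivity)
  have t1 : ‖(Complex.exp (-(x / 24 : ℝ) * w) - 1) * c * Complex.exp E‖ ≤ x * 2 * Q := by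
    rw [norm_mul, norm_mul]; gcongr
  have t2 : ‖(c - 1 - v * Complex.I / 2) * Complex.exp E‖ ≤ v ^ 2 / 2 * Q := by
    rw [norm_mul]; gcongr
  have t3 : ‖Complex.exp E - 1 - E‖ ≤ u ^ 2 * v ^ 2 * Q := by
    refine x3.trans ?_
    have : ‖E‖ ^ 2 ≤ (u * |v|) ^ 2 := by gcongr
    rw [mul_pow, sq_abs] at this
    gcongr
  have t4 : ‖E - (M * v ^ 3 : ℝ) * Complex.I‖ ≤ u * v ^ 2 * Q :=
    x4.trans (le_mul_of_one_le_right (by positivity) hQ1)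
  have t5 : ‖(v * Complex.I / 2) * (Complex.exp E - 1)‖ ≤ u * v ^ 2 / 2 * Q := by
    rw [norm_mul]
    have : ‖(v * Complex.I / 2 : ℂ)‖ = |v| / 2 := by simp
    rw [this]
    calc |v| / 2 * ‖Complex.exp E - 1‖ ≤ |v| / 2 * ((u * |v|) * Q) := by
          gcongr
          exact x2.trans (by gcongr)
      _ = u * |v| ^ 2 / 2 * Q := by ring
      _ = _ := by rw [sq_abs]
  have tot := norm_add_le_of_le (norm_add_le_of_le (norm_add_le_of_le (norm_add_le_of_le t1 t2) t3) t4) t5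
  have hq : 1 + u / 8 + (u / 8) ^ 2 / 2 ≤ exp (u / 8) := by
    exact quadratic_le_exp_of_nonneg (by positivity)
  have e1 : 1 ≤ exp (u / 8) := one_le_exp (by positivity)
  calc exp (-u) * _ ≤ exp (-u) * (x * 2 * Q + v ^ 2 / 2 * Q + u ^ 2 * v ^ 2 * Q
        + u * v ^ 2 * Q + u * v ^ 2 / 2 * Q) := by gcongr
    _ = (2 * x + v ^ 2 * (1 / 2 + 3 / 2 * u + u ^ 2)) * (exp (-u) * Q) := by ring
    _ ≤ (2 * x * exp (u / 8) + v ^ 2 * (128 * exp (u / 8))) * (exp (-u) * Q) := by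
        have hA : 2 * x ≤ 2 * x * exp (u / 8) := le_mul_of_one_le_right (by positivity) e1
        have hB : 1 / 2 + 3 / 2 * u + u ^ 2 ≤ 128 * exp (u / 8) := by nlinarith
        exact mul_le_mul_of_nonneg_right
          (add_le_add hA (mul_le_mul_of_nonneg_left hB (sq_nonneg v))) (by positivity)
    _ = (2 * x + 128 * v ^ 2) * (exp (u / 8) * (exp (-u) * Q)) := by ring
    _ = (2 * x + 128 * v ^ 2) * exp (-u / 8) := by
        rw [hQ, ← exp_add, ← exp_add]; ring_nf

lemma HH_continuous (x M : ℝ) : Continuous (HH x M) := by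
  unfold HH
  have h1 : Continuous fun v : ℝ => Complex.sqrt (1 + v * Complex.I) := by
    simp only [Complex.sqrt]
    apply Continuous.cpow (by fun_prop) (by fun_prop)
    intro v
    left; simp
  have h2 : Continuous fun v : ℝ => Complex.exp (-(M * v ^ 2 : ℝ) / (1 + v * Complex.I)) := by
    apply Complex.continuous_exp.comp
    exact Continuous.div (by fun_prop) (by fun_prop) one_add_ne
  exact (Continuous.mul (by fun_prop) h1).mul h2

lemma sq_mul_exp {M b v : ℝ} (hM : 0 < M) (hb : M / 8 ≤ b) :
    v ^ 2 * exp (-b * v ^ 2) ≤ 16 / M * exp (-(M / 16) * v ^ 2) := by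
  have h1 : M / 16 * v ^ 2 ≤ exp (M / 16 * v ^ 2) := by
    linarith [add_one_le_exp (M / 16 * v ^ 2)]
  have h2 : v ^ 2 ≤ 16 / M * exp (M / 16 * v ^ 2) := by
    rw [div_mul_eq_mul_div, le_div_iff₀ hM]; linarith
  calc v ^ 2 * exp (-b * v ^ 2) ≤ 16 / M * exp (M / 16 * v ^ 2) * exp (-(M / 8) * v ^ 2) := by
        gcongr
    _ = _ := by rw [mul_assoc, ← exp_add]; ring_nf

lemma odd_int (M : ℝ) : ∫ v in (-1:ℝ)..1, exp (-M * v ^ 2) * (v / 2 + M * v ^ 3) = 0 := by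
  have h := intervalIntegral.integral_comp_neg (a := -1) (b := 1)
    (fun v : ℝ => exp (-M * v ^ 2) * (v / 2 + M * v ^ 3))
  rw [neg_neg] at h
  have e : (fun v : ℝ => exp (-M * (-v) ^ 2) * (-v / 2 + M * (-v) ^ 3))
      = fun v => -(exp (-M * v ^ 2) * (v / 2 + M * v ^ 3)) := by
    ext v; ring_nf
  rw [e, intervalIntegral.integral_neg] at h
  linarith

lemma gauss_tail {M : ℝ} (hM : 0 < M) :
    |(∫ v in (-1:ℝ)..1, exp (-M * v ^ 2)) - √(π / M)| ≤ 64 / M * √(π / M) := by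
  have hi := integrable_exp_neg_mul_sq hM
  have hi' := integrable_exp_neg_mul_sq (b := M / 16) (by positivity)
  have hg : ∫ v : ℝ, 16 / M * exp (-(M / 16) * v ^ 2) = 64 / M * √(π / M) := by
    rw [MeasureTheory.integral_const_mul, integral_gaussian]
    have : π / (M / 16) = 4 ^ 2 * (π / M) := by field_simp; norm_num
    rw [this, sqrt_mul (by norm_num), sqrt_sq (by norm_num)]; ring
  rw [← hg, ← integral_gaussian M, intervalIntegral.integral_of_le (by norm_num),
    ← MeasureTheory.integral_indicator measurableSet_Ioc,
    ← MeasureTheory.integral_sub (hi.indicator measurableSet_Ioc) hi, ← Real.norm_eq_abs]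
  apply MeasureTheory.norm_integral_le_of_norm_le (hi'.const_mul _)
  refine Filter.Eventually.of_forall fun v => ?_
  by_cases hv : v ∈ Set.Ioc (-1:ℝ) 1
  · simp only [Set.indicator_of_mem hv, sub_self, norm_zero]; positivity
  · simp only [Set.indicator_of_notMem hv, zero_sub, norm_neg]
    rw [Real.norm_of_nonneg (exp_pos _).le]
    have h1 : 1 ≤ v ^ 2 := by
      rw [Set.mem_Ioc, not_and_or, not_lt, not_le] at hv
      rcases hv with h | h <;> nlinarith
    refine le_trans ?_ (sq_mul_exp hM (by linarith : M / 8 ≤ M))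
    exact le_mul_of_one_le_left (exp_pos _).le h1

lemma laplace {x M : ℝ} (hx : 0 ≤ x) (hx2 : x ≤ 2) (hM : 0 < M) (hxM : x ≤ 2 / M) :
    ‖(∫ v in (-1:ℝ)..1, HH x M v) - ((√(π / M) : ℝ) : ℂ)‖ ≤ 9000 / M * √(π / M) := by
  have hi' := integrable_exp_neg_mul_sq (b := M / 16) (by positivity)
  have hg : ∫ v : ℝ, 2052 / M * exp (-(M / 16) * v ^ 2) = 8208 / M * √(π / M) := by
    rw [MeasureTheory.integral_const_mul, integral_gaussian]
    have : π / (M / 16) = 4 ^ 2 * (π / M) := by field_simp; norm_num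
    rw [this, sqrt_mul (by norm_num), sqrt_sq (by norm_num)]; ring
  set A : ℝ → ℂ := fun v => ((exp (-M * v ^ 2) : ℝ) : ℂ) *
      (1 + ((v / 2 + M * v ^ 3 : ℝ) : ℂ) * Complex.I) with hA
  have hAc : Continuous A := by rw [hA]; fun_prop
  have hAi : ∫ v in (-1:ℝ)..1, A v = ((∫ v in (-1:ℝ)..1, exp (-M * v ^ 2) : ℝ) : ℂ) := by
    have e : ∀ v, A v = ((exp (-M * v ^ 2) : ℝ) : ℂ) +
        ((exp (-M * v ^ 2) * (v / 2 + M * v ^ 3) : ℝ) : ℂ) * Complex.I := by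
      intro v; rw [hA]; push_cast; ring
    simp only [e]
    rw [intervalIntegral.integral_add, intervalIntegral.integral_mul_const,
      intervalIntegral.integral_ofReal, intervalIntegral.integral_ofReal, odd_int]
    · simp
    · exact Continuous.intervalIntegrable (by fun_prop) _ _
    · exact Continuous.intervalIntegrable (by fun_prop) _ _
  have h1 : ‖∫ v in (-1:ℝ)..1, (HH x M v - A v)‖ ≤ 8208 / M * √(π / M) := by
    have h2 := intervalIntegral.norm_integral_le_of_norm_le (μ := MeasureTheory.volume)
      (a := -1) (b := 1) (f := fun v => HH x M v - A v)
      (g := fun v => 2052 / M * exp (-(M / 16) * v ^ 2)) (by norm_num)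
      (Filter.Eventually.of_forall fun v hv => ?_)
      (Continuous.intervalIntegrable (by fun_prop) _ _)
    · refine h2.trans ?_
      rw [← hg, intervalIntegral.integral_of_le (by norm_num)]
      apply MeasureTheory.setIntegral_le_integral (hi'.const_mul _)
      exact Filter.Eventually.of_forall fun v => by positivity
    · have hv' : |v| ≤ 1 := abs_le.mpr ⟨hv.1.le, hv.2⟩
      refine (HH_approx hx hx2 hM hv').trans ?_
      have e : -M * v ^ 2 / 8 = -(M / 8) * v ^ 2 := by ring
      rw [e, add_mul, mul_assoc 128]
      have a1 := sq_mul_exp (v := v) hM (le_refl (M / 8))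
      have a2 : exp (-(M / 8) * v ^ 2) ≤ exp (-(M / 16) * v ^ 2) := by
        rw [exp_le_exp]; nlinarith [sq_nonneg v]
      calc 2 * x * exp (-(M / 8) * v ^ 2) + 128 * (v ^ 2 * exp (-(M / 8) * v ^ 2))
          ≤ 2 * (2 / M) * exp (-(M / 16) * v ^ 2) + 128 * (16 / M * exp (-(M / 16) * v ^ 2)) := by
            gcongr
        _ = _ := by ring
  rw [intervalIntegral.integral_sub ((HH_continuous x M).intervalIntegrable _ _)
    (hAc.intervalIntegrable _ _), hAi] at h1
  have h3 := gauss_tail hM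
  have h4 : ‖((∫ v in (-1:ℝ)..1, exp (-M * v ^ 2) : ℝ) : ℂ) - ((√(π / M) : ℝ) : ℂ)‖
      ≤ 64 / M * √(π / M) := by
    rw [← Complex.ofReal_sub, Complex.norm_real]; exact h3
  have h5 := norm_add_le_of_le h1 h4
  rw [sub_add_sub_cancel] at h5
  refine h5.trans ?_
  rw [← add_mul, ← add_div]
  gcongr
  norm_num

end PA

namespace PA

lemma core {n : ℕ} {x M : ℝ} (hx : 0 < x) (hx2 : x ≤ 2) (hM : 0 < M) (hxM : x ≤ 2 / M)
    (h1 : n * x = M) (h2 : π ^ 2 / 6 / x = M) :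
    |2 * π * (pc n : ℝ) - x * (√(x / (2 * π)) * exp (2 * M)) * √(π / M)|
      ≤ 2 * π * exp (7 / 4 * M) + 2 * x * exp (1 - 4 * M)
        + x * (√(x / (2 * π)) * exp (2 * M)) * (9000 / M * √(π / M)) := by
  have hxpi : x ≤ π := hx2.trans (by linarith [pi_gt_three])
  set G : ℝ → ℂ := fun θ =>
    PP (Complex.exp (-(x + θ * Complex.I))) * Complex.exp (n * (x + θ * Complex.I)) with hG
  have hGc : Continuous G := (PP_continuous hx).mul (by fun_prop)
  set K : ℝ := √(x / (2 * π)) * exp (2 * M) with hK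
  have hK0 : 0 ≤ K := by positivity
  have hGi : ∀ a b : ℝ, IntervalIntegrable G MeasureTheory.volume a b :=
    fun a b => hGc.intervalIntegrable a b
  have hc : ∫ θ in (-π)..π, G θ = 2 * π * pc n := cauchy hx n
  have hsplit : (∫ θ in (-π)..π, G θ) = (∫ θ in (-π)..(-x), G θ) + (∫ θ in (-x)..x, G θ)
      + ∫ θ in x..π, G θ := by
    rw [intervalIntegral.integral_add_adjacent_intervals (hGi _ _) (hGi _ _),
      intervalIntegral.integral_add_adjacent_intervals (hGi _ _) (hGi _ _)]
  have hmin : ∀ θ : ℝ, x ≤ |θ| → |θ| ≤ π → ‖G θ‖ ≤ exp (7 / 4 * M) := by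
    intro θ ha hb
    have := minor (n := n) hx hxpi ha hb
    rw [h1, h2] at this
    refine this.trans (le_of_eq ?_)
    ring_nf
  have b1 : ‖∫ θ in (-π)..(-x), G θ‖ ≤ exp (7 / 4 * M) * π := by
    have := intervalIntegral.norm_integral_le_of_norm_le_const (a := -π) (b := -x) (f := G)
      (C := exp (7 / 4 * M)) (fun θ hθ => by
        rw [Set.uIoc_of_le (by linarith)] at hθ
        have h0 : |θ| = -θ := abs_of_neg (by linarith [hθ.2])
        exact hmin θ (by linarith [hθ.2]) (by linarith [hθ.1]))
    refine this.trans ?_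
    rw [abs_of_nonneg (by linarith)]
    exact mul_le_mul_of_nonneg_left (by linarith) (exp_pos _).le
  have b3 : ‖∫ θ in x..π, G θ‖ ≤ exp (7 / 4 * M) * π := by
    have := intervalIntegral.norm_integral_le_of_norm_le_const (a := x) (b := π) (f := G)
      (C := exp (7 / 4 * M)) (fun θ hθ => by
        rw [Set.uIoc_of_le (by linarith)] at hθ
        have h0 : |θ| = θ := abs_of_pos (by linarith [hθ.1])
        exact hmin θ (by linarith [hθ.1]) (by linarith [hθ.2]))
    refine this.trans ?_
    rw [abs_of_nonneg (by linarith)]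
    exact mul_le_mul_of_nonneg_left (by linarith) (exp_pos _).le
  have hscale : (∫ θ in (-x)..x, G θ) = x * ∫ v in (-1:ℝ)..1, G (x * v) := by
    have := intervalIntegral.smul_integral_comp_mul_left (a := -1) (b := 1) G x
    rw [mul_neg, mul_one] at this
    rw [← this, Complex.real_smul]
  have b2 : ‖(∫ v in (-1:ℝ)..1, G (x * v)) - K * ∫ v in (-1:ℝ)..1, HH x M v‖
      ≤ 2 * exp (1 - 4 * M) := by
    have c1 : Continuous fun v : ℝ => G (x * v) := hGc.comp (continuous_const.mul continuous_id)
    have c2 : Continuous fun v : ℝ => (K : ℂ) * HH x M v :=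
      continuous_const.mul (HH_continuous x M)
    rw [← intervalIntegral.integral_const_mul, ← intervalIntegral.integral_sub
      (c1.intervalIntegrable _ _) (c2.intervalIntegrable _ _)]
    have := intervalIntegral.norm_integral_le_of_norm_le_const (a := -1) (b := 1)
      (f := fun v : ℝ => G (x * v) - (K : ℂ) * HH x M v)
      (C := exp (1 - 4 * M)) (fun v hv => by
        rw [Set.uIoc_of_le (by norm_num)] at hv
        have hv1 : |v| ≤ 1 := abs_le.mpr ⟨hv.1.le, hv.2⟩
        have hθ : |x * v| ≤ x := by
          rw [abs_mul, abs_of_pos hx]; exact mul_le_of_le_one_right hx.le hv1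
        have h3 := major (n := n) hx hx2 hθ
        have h4 := mainF_scale hx h1 h2 v
        rw [h4, h1, h2] at h3
        refine le_trans (le_of_eq ?_) (h3.trans (le_of_eq ?_))
        · simp only [hG, HH, hK]
        · ring_nf)
    refine this.trans ?_
    norm_num
    linarith
  have b4 := laplace hx.le hx2 hM hxM
  have key : ((2 * π * (pc n : ℝ) - x * K * √(π / M) : ℝ) : ℂ)
      = (∫ θ in (-π)..(-x), G θ) + (∫ θ in x..π, G θ)
        + x * ((∫ v in (-1:ℝ)..1, G (x * v)) - K * ∫ v in (-1:ℝ)..1, HH x M v)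
        + (x * K : ℝ) * ((∫ v in (-1:ℝ)..1, HH x M v) - ((√(π / M) : ℝ) : ℂ)) := by
    have : (2 * π * pc n : ℂ) = (∫ θ in (-π)..(-x), G θ) + (x * ∫ v in (-1:ℝ)..1, G (x * v))
      + ∫ θ in x..π, G θ := by rw [← hc, hsplit, hscale]
    push_cast
    rw [this]; ring
  rw [← Real.norm_eq_abs, ← Complex.norm_real, key]
  have b2' : ‖(x : ℂ) * ((∫ v in (-1:ℝ)..1, G (x * v)) - K * ∫ v in (-1:ℝ)..1, HH x M v)‖
      ≤ x * (2 * exp (1 - 4 * M)) := by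
    rw [norm_mul, Complex.norm_real, Real.norm_of_nonneg hx.le]
    exact mul_le_mul_of_nonneg_left b2 hx.le
  have b4' : ‖((x * K : ℝ) : ℂ) * ((∫ v in (-1:ℝ)..1, HH x M v) - ((√(π / M) : ℝ) : ℂ))‖
      ≤ x * K * (9000 / M * √(π / M)) := by
    rw [norm_mul, Complex.norm_real, Real.norm_of_nonneg (by positivity)]
    exact mul_le_mul_of_nonneg_left b4 (by positivity)
  refine (norm_add_le_of_le (norm_add_le_of_le (norm_add_le_of_le b1 b3) b2') b4').trans
    (le_of_eq ?_)
  ring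

set_option maxHeartbeats 1000000 in
lemma final (n : ℕ) (hn : 1 ≤ n) :
    |(pc n : ℝ) - Real.exp (π * Real.sqrt (2 * n / 3)) / (4 * Real.sqrt 3 * n)| ≤
        17000 * (n : ℝ) ^ (-(1 : ℝ) / 2) *
          (Real.exp (π * Real.sqrt (2 * n / 3)) / (4 * Real.sqrt 3 * n)) := by
  have hn1 : (1:ℝ) ≤ n := by exact_mod_cast hn
  have hn0 : (0:ℝ) < n := by linarith
  have hpi3 := pi_gt_three
  have hpi4 := pi_lt_d2
  set s := √(n:ℝ) with hs
  have hs2 : s ^ 2 = n := sq_sqrt hn0.le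
  have hs1 : 1 ≤ s := one_le_sqrt.mpr hn1
  have hs0 : 0 < s := by linarith
  set r := √(6:ℝ) with hr
  have hr2 : r ^ 2 = 6 := sq_sqrt (by norm_num)
  have hr0 : 0 < r := sqrt_pos.mpr (by norm_num)
  have hrl : 2.4 ≤ r := by rw [hr]; apply le_sqrt_of_sq_le; norm_num
  have hru : r ≤ 2.5 := by rw [hr]; apply sqrt_le_iff.mpr; norm_num
  set x := π / (r * s) with hx
  set M := π * s / r with hMd
  have hx0 : 0 < x := by positivity
  have hM0 : 0 < M := by positivity
  have hx2 : x ≤ 2 := by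
    rw [hx, div_le_iff₀ (by positivity)]; nlinarith
  have h1 : n * x = M := by
    rw [hx, hMd, ← hs2]; field_simp
  have h2 : π ^ 2 / 6 / x = M := by
    rw [hx, hMd, ← hr2]; field_simp
  have hMs : s ≤ M := by
    rw [hMd, le_div_iff₀ hr0]; nlinarith
  have hxM : x ≤ 2 / M := by
    rw [le_div_iff₀ hM0, hx, hMd]
    have : π / (r * s) * (π * s / r) = π ^ 2 / 6 := by rw [← hr2]; field_simp
    rw [this]; nlinarith
  have hc := core hx0 hx2 hM0 hxM h1 h2
  have h2M : π * √(2 * n / 3) = 2 * M := by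
    have : (2 * n / 3 : ℝ) = (2 * s / r) ^ 2 := by rw [div_pow, mul_pow, hr2, hs2]; ring
    rw [this, sqrt_sq (by positivity), hMd]; ring
  have hrp : (n:ℝ) ^ (-(1:ℝ) / 2) = 1 / s := by
    rw [neg_div, rpow_neg hn0.le, ← sqrt_eq_rpow, one_div]
  rw [h2M, hrp]
  set B := exp (2 * M) / (4 * √3 * n) with hB
  have hB0 : 0 < B := by positivity
  have h3 : √(3:ℝ) ^ 2 = 3 := sq_sqrt (by norm_num)
  have h30 : 0 < √(3:ℝ) := by positivity
  have hLB : x * (√(x / (2 * π)) * exp (2 * M)) * √(π / M) = 2 * π * B := by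
    have e1 : √(x / (2 * π)) * √(π / M) = r / (2 * √3 * s) := by
      rw [← sqrt_mul (by positivity), ← sqrt_sq (x := r / (2 * √3 * s)) (by positivity)]
      congr 1
      rw [hx, hMd, div_pow, mul_pow, mul_pow, h3]
      field_simp
      nlinarith
    calc _ = x * (√(x / (2 * π)) * √(π / M)) * exp (2 * M) := by ring
      _ = _ := by
        rw [e1, hx, hB, ← hs2]; field_simp; norm_num
  have hLB' : x * (√(x / (2 * π)) * exp (2 * M)) * (9000 / M * √(π / M))
      = 9000 / M * (2 * π * B) := by rw [← hLB]; ring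
  rw [hLB', hLB, ← mul_sub, abs_mul, abs_of_pos (by positivity : 0 < 2 * π)] at hc
  have e1 : exp (1 - 4 * M) ≤ 3 * exp (7 / 4 * M) := by
    rw [sub_eq_add_neg, exp_add]
    have := exp_one_lt_d9
    have h5 : exp (-(4 * M)) ≤ exp (7 / 4 * M) := exp_le_exp.mpr (by linarith)
    exact mul_le_mul (by linarith) h5 (exp_pos _).le (by norm_num)
  have e2 : M ^ 3 / 384 ≤ exp (M / 4) := by
    have := pow_div_factorial_le_exp (M / 4) (by positivity) 3
    refine le_trans (le_of_eq ?_) this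
    norm_num [Nat.factorial]; ring
  have e3 : exp (2 * M) = B * (4 * √3 * n) := by rw [hB]; field_simp
  have e4 : (n:ℝ) ≤ 2 / 3 * M ^ 2 := by
    have : M ^ 2 = π ^ 2 * n / 6 := by rw [hMd, div_pow, mul_pow, hr2, hs2]
    rw [this]
    have h9 : 9 ≤ π ^ 2 := by nlinarith
    have h10 := mul_le_mul_of_nonneg_right h9 hn0.le
    linarith
  have e5 : exp (2 * M) ≤ B * (5 * M ^ 2) := by
    rw [e3]
    have h31 : √(3:ℝ) ≤ 1.75 := by apply sqrt_le_iff.mpr; norm_num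
    have h32 : √(3:ℝ) * n ≤ 1.75 * (2 / 3 * M ^ 2) :=
      mul_le_mul h31 e4 hn0.le (by norm_num)
    have h33 : 4 * √(3:ℝ) * n ≤ 5 * M ^ 2 := by nlinarith [sq_nonneg M]
    exact mul_le_mul_of_nonneg_left h33 hB0.le
  have e6 : exp (7 / 4 * M) ≤ 1920 / M * B := by
    have : exp (2 * M) = exp (7 / 4 * M) * exp (M / 4) := by rw [← exp_add]; ring_nf
    have h6 : exp (7 / 4 * M) * (M ^ 3 / 384) ≤ B * (5 * M ^ 2) := by
      refine le_trans ?_ e5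
      rw [this]
      exact mul_le_mul_of_nonneg_left e2 (exp_pos _).le
    rw [div_mul_eq_mul_div 1920 M B, le_div_iff₀ hM0]
    have : M ^ 2 * (exp (7 / 4 * M) * M) ≤ M ^ 2 * (1920 * B) := by nlinarith
    exact le_of_mul_le_mul_left this (by positivity)
  have e7 : 2 * x * exp (1 - 4 * M) ≤ 2 * π * (3 * exp (7 / 4 * M)) := by
    apply mul_le_mul (by linarith) e1 (exp_pos _).le (by positivity)
  have e8 : 2 * π * |(pc n : ℝ) - B| ≤ 2 * π * (17000 / M * B) := by
    have h7 : 17000 / M * B = 4 * (1920 / M * B) + 9000 / M * B + 320 / M * B := by ring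
    have h8 : 0 ≤ 320 / M * B := by positivity
    have h9 : 4 * exp (7 / 4 * M) + 9000 / M * B ≤ 17000 / M * B := by linarith
    have h10 := mul_le_mul_of_nonneg_left h9 (by positivity : 0 ≤ 2 * π)
    linarith
  have e9 := le_of_mul_le_mul_left e8 (by positivity)
  refine e9.trans ?_
  have : 17000 / M ≤ 17000 * (1 / s) := by
    rw [mul_one_div]; gcongr
  exact mul_le_mul_of_nonneg_right this hB0.le

end PA
/-- Rademacher's estimate: `p(n) = (1 + O(n^{-1/2})) · e^{π√(2n/3)} / (4√3 n)`. -/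
theorem partition_asymptotic :
    ∃ C : ℝ, 0 < C ∧ ∀ n : ℕ, 1 ≤ n →
      |(Nat.card (Nat.Partition n) : ℝ) -
          Real.exp (π * Real.sqrt (2 * n / 3)) / (4 * Real.sqrt 3 * n)| ≤
        C * (n : ℝ) ^ (-(1 : ℝ) / 2) *
          (Real.exp (π * Real.sqrt (2 * n / 3)) / (4 * Real.sqrt 3 * n)) := by
  exact ⟨17000, by norm_num, fun n hn => PA.final n hn⟩
end

section
/- Fix a prime p, a positive integer k coprime to p, and a partition μ of n with reduced partition μ̃ (no part repeated p or more times). Then for each j ≥ 0, the number of parts of μ̃ equal to k·p^j is the digit of p^j in the base-p expansion of M_μ^{(k)}/k, where M_μ^{(k)} is the sum of parts of μ of the form k·p^i. In particular, μ̃ has a part of size at least k·p^{⌊log_p(M_μ^{(k)}/k)⌋} whenever M_μ^{(k)} > 0. -/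
def MergeStep (p : ℕ) (s t : Multiset ℕ) : Prop :=
  ∃ m : ℕ, 0 < m ∧ Multiset.replicate p m ≤ s ∧
    t = (s - Multiset.replicate p m) + {p * m}

def Reduced (p : ℕ) (s : Multiset ℕ) : Prop := ∀ m : ℕ, s.count m ≤ p - 1

/-- `M_s^{(k)}`: the sum of the parts of `s` of the form `k·p^j`. -/
noncomputable def Msum (p k : ℕ) (s : Multiset ℕ) : ℕ :=
  letI := Classical.decPred fun a : ℕ => ∃ j : ℕ, a = k * p ^ j
  (s.filter fun a : ℕ => ∃ j : ℕ, a = k * p ^ j).sum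

theorem Msum_add' (p k : ℕ) (s t : Multiset ℕ) : Msum p k (s + t) = Msum p k s + Msum p k t := by
  classical
  simp [Msum, Multiset.filter_add]

open Classical in
theorem Msum_single' (p k a : ℕ) : Msum p k {a} = if ∃ j : ℕ, a = k * p ^ j then a else 0 := by
  unfold Msum
  rw [Multiset.filter_singleton]
  split_ifs <;> simp

theorem Msum_replicate' (p k a m : ℕ) : Msum p k (Multiset.replicate m a) = m * Msum p k {a} := by
  induction m with
  | zero => simp [Msum]
  | succ m ih =>
    rw [Multiset.replicate_succ, ← Multiset.singleton_add, Msum_add', ih]; ring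

theorem Msum_step' (p k : ℕ) (hp : p.Prime) (hk : Nat.Coprime k p) (s t : Multiset ℕ)
    (h : MergeStep p s t) : Msum p k s = Msum p k t := by
  classical
  obtain ⟨m, hm, hle, rfl⟩ := h
  conv_lhs => rw [← Multiset.sub_add_cancel hle]
  rw [Msum_add', Msum_add', Msum_replicate', Msum_single', Msum_single']
  have : (∃ j : ℕ, m = k * p ^ j) ↔ ∃ j : ℕ, p * m = k * p ^ j := by
    constructor
    · rintro ⟨j, rfl⟩
      exact ⟨j + 1, by ring⟩
    · rintro ⟨j, hj⟩
      cases j with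
      | zero =>
        exfalso
        have h1 : p ∣ k := ⟨m, by simpa using hj.symm⟩
        exact (hp.coprime_iff_not_dvd.1 hk.symm) h1
      | succ j =>
        refine ⟨j, Nat.eq_of_mul_eq_mul_left hp.pos ?_⟩
        rw [hj]; ring
  by_cases h : ∃ j : ℕ, m = k * p ^ j
  · rw [if_pos h, if_pos (this.1 h)]
  · rw [if_neg h, if_neg (fun h' => h (this.2 h'))]; simp

theorem Msum_eq' (p k : ℕ) (hp : p.Prime) (hk0 : 0 < k) (N : ℕ) (s : Multiset ℕ)
    (h : ∀ a ∈ s, a < N) :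
    Msum p k s = k * ∑ j ∈ Finset.range N, s.count (k * p ^ j) * p ^ j := by
  classical
  induction s using Multiset.induction_on with
  | empty => simp [Msum]
  | cons a s ih =>
    rw [← Multiset.singleton_add, Msum_add', ih (fun b hb => h b (Multiset.mem_cons_of_mem hb)),
      Msum_single']
    simp only [Multiset.count_add, add_mul, Finset.sum_add_distrib, mul_add]
    congr 1
    split_ifs with h1
    · obtain ⟨i, rfl⟩ := h1
      have hi : i < N := by
        have h2 := h _ (Multiset.mem_cons_self _ _)
        have h3 : i < p ^ i := Nat.lt_pow_self hp.one_lt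
        have h4 : p ^ i ≤ k * p ^ i := Nat.le_mul_of_pos_left _ hk0
        omega
      rw [Finset.sum_eq_single i]
      · simp
      · intro j _ hj
        rw [Multiset.count_singleton, if_neg, zero_mul]
        intro e
        exact hj (Nat.pow_right_injective hp.two_le (Nat.eq_of_mul_eq_mul_left hk0 e))
      · intro h'; exact absurd (Finset.mem_range.2 hi) h'
    · symm
      rw [Finset.sum_eq_zero, mul_zero]
      intro j _
      rw [Multiset.count_singleton, if_neg, zero_mul]
      intro e
      exact h1 ⟨j, e.symm⟩

theorem digit_sum' (p : ℕ) (hp : 0 < p) (j : ℕ) : ∀ (c : ℕ → ℕ) (_ : ∀ i, c i < p) (N : ℕ), j < N →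
    (∑ i ∈ Finset.range N, c i * p ^ i) / p ^ j % p = c j := by
  induction j with
  | zero =>
    intro c hc N hN
    obtain ⟨N, rfl⟩ : ∃ M, N = M + 1 := ⟨N - 1, by omega⟩
    rw [Finset.sum_range_succ']
    have : ∑ i ∈ Finset.range N, c (i + 1) * p ^ (i + 1)
        = p * ∑ i ∈ Finset.range N, c (i + 1) * p ^ i := by
      rw [Finset.mul_sum]; exact Finset.sum_congr rfl fun i _ => by ring
    rw [this]
    simp [Nat.mul_add_mod, Nat.mod_eq_of_lt (hc 0)]
  | succ j ih =>
    intro c hc N hN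
    obtain ⟨N, rfl⟩ : ∃ M, N = M + 1 := ⟨N - 1, by omega⟩
    rw [Finset.sum_range_succ']
    have : ∑ i ∈ Finset.range N, c (i + 1) * p ^ (i + 1)
        = p * ∑ i ∈ Finset.range N, c (i + 1) * p ^ i := by
      rw [Finset.mul_sum]; exact Finset.sum_congr rfl fun i _ => by ring
    rw [this, pow_succ', ← Nat.div_div_eq_div_mul, pow_zero, mul_one, Nat.mul_add_div hp,
      Nat.div_eq_of_lt (hc 0), add_zero]
    exact ih (fun i => c (i + 1)) (fun i => hc _) N (by omega)

/-- For the reduced partition `ν = μ̃` of `μ`, the number of parts equal to `k·p^j` is the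
`p^j`-digit of the base-`p` expansion of `M_μ^{(k)}/k`; in particular `μ̃` has a part of size
at least `k·p^{⌊log_p(M_μ^{(k)}/k)⌋}` whenever `M_μ^{(k)} > 0`. -/
theorem reduction_digits (p k n : ℕ) (hp : p.Prime) (hk0 : 0 < k) (hk : Nat.Coprime k p)
    (μ : Nat.Partition n) (ν : Multiset ℕ)
    (hreach : Relation.ReflTransGen (MergeStep p) μ.parts ν)
    (hred : Reduced p ν) :
    (∀ j : ℕ, ν.count (k * p ^ j) = Msum p k μ.parts / k / p ^ j % p) ∧
    (0 < Msum p k μ.parts →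
      ∃ a ∈ ν, k * p ^ (Nat.log p (Msum p k μ.parts / k)) ≤ a) := by
  have hM : Msum p k μ.parts = Msum p k ν := by
    clear hred
    induction hreach with
    | refl => rfl
    | tail _ h ih => exact ih.trans (Msum_step' p k hp hk _ _ h)
  rw [hM]
  have hdig : ∀ j N : ℕ, (∀ a ∈ ν, a < N) → j < N →
      Msum p k ν / k / p ^ j % p = ν.count (k * p ^ j) := by
    intro j N h1 h2
    rw [Msum_eq' p k hp hk0 N ν h1, Nat.mul_div_cancel_left _ hk0]
    exact digit_sum' p hp.pos j (fun j => ν.count (k * p ^ j))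
      (fun i => by have := hred (k * p ^ i); have := hp.pos; omega) N h2
  have hN : ∀ a ∈ ν, a < ν.sum + 1 := fun a ha => Nat.lt_succ_of_le (Multiset.le_sum_of_mem ha)
  have hall : ∀ j : ℕ, ν.count (k * p ^ j) = Msum p k ν / k / p ^ j % p := fun j =>
    (hdig j (ν.sum + 1 + j) (fun a ha => by have := hN a ha; omega) (by omega)).symm
  refine ⟨hall, fun hpos => ⟨_, ?_, le_rfl⟩⟩
  rw [← Multiset.count_pos, hall]
  have hS := Msum_eq' p k hp hk0 _ ν hN
  generalize ∑ j ∈ Finset.range (ν.sum + 1), ν.count (k * p ^ j) * p ^ j = S at hS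
  rw [hS] at hpos ⊢
  rw [Nat.mul_div_cancel_left _ hk0]
  have hS0 : S ≠ 0 := by rintro rfl; simp at hpos
  have hlt : S / p ^ Nat.log p S < p := by
    rw [Nat.div_lt_iff_lt_mul (pow_pos hp.pos _), ← pow_succ']
    exact Nat.lt_pow_succ_log_self hp.one_lt S
  rw [Nat.mod_eq_of_lt hlt]
  exact Nat.div_pos (Nat.pow_log_le_self p hS0) (pow_pos hp.pos _)
end
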